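/- arXiv:1907.04588 — 4 statements merged into one kernel-verified Lean document; each statement's English description precedes it below -/
import Mathlib

section
/- For all positive integers m and n with m ≡ 2 (mod 4) and n ≡ 2 (mod 4), Θ(m,n,3,2,1) = ⌊(5mn+4)/24⌋; that is, there exists an (m,n,3,2,1)-OOSPC with ⌊(5mn+4)/24⌋ codewords, and every (m,n,3,2,1)-OOSPC has at most ⌊(5mn+4)/24⌋ codewords. -/
open Finset

/-- An (m,n,k,lamA,lamC)-OOSPC: a family of k-subsets of Z_m x Z_n with
auto-correlation at most lamA and cross-correlation at most lamC. -/
def OOSPC (m n k lamA lamC : ℕ) (F : Finset (Finset (ZMod m × ZMod n))) : Prop :=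
  (∀ X ∈ F, X.card = k) ∧
  (∀ X ∈ F, ∀ g : ZMod m × ZMod n, g ≠ 0 →
    (X ∩ X.image (fun x => g + x)).card ≤ lamA) ∧
  (∀ X ∈ F, ∀ Y ∈ F, X ≠ Y → ∀ g : ZMod m × ZMod n,
    (X ∩ Y.image (fun x => g + x)).card ≤ lamC)

/-- The leave of a family: nonzero elements of Z_m x Z_n not occurring as a
difference of two elements of a member of the family. -/
def leave (m n : ℕ) (F : Finset (Finset (ZMod m × ZMod n))) : Set (ZMod m × ZMod n) :=
  {g | g ≠ 0 ∧ ∀ X ∈ F, ∀ x ∈ X, ∀ y ∈ X, x - y ≠ g}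

/-- (s,t)-regularity: the leave together with 0 equals S × T, where S and T are the
unique subgroups of order s of Z_m and of order t of Z_n (for s ∣ m, t ∣ n these are
exactly the elements killed by s, resp. t). -/
def Regular (m n s t : ℕ) (F : Finset (Finset (ZMod m × ZMod n))) : Prop :=
  insert (0 : ZMod m × ZMod n) (leave m n F) =
    {p : ZMod m × ZMod n | s • p.1 = 0 ∧ t • p.2 = 0}

/-- ξ: the number of subgroups of order 3 in Z_m × Z_n. -/
def xi (m n : ℕ) : ℕ := if 3 ∣ m ∧ 3 ∣ n then 4 else if 3 ∣ m * n then 1 else 0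

/-- ω = 0 if lamA = 2, and ω = ξ if lamA = 3. -/
def omega (lamA m n : ℕ) : ℕ := if lamA = 2 then 0 else xi m n

/-- The `(3, 2, 1)` correlation conditions for a family of triples in an abelian group. -/
def IsCode {G : Type*} [AddCommGroup G] [DecidableEq G] (F : Finset (Finset G)) : Prop :=
  (∀ X ∈ F, X.card = 3) ∧
  (∀ X ∈ F, ∀ g : G, g ≠ 0 → (X ∩ X.image (fun x => g + x)).card ≤ 2) ∧
  (∀ X ∈ F, ∀ Y ∈ F, X ≠ Y → ∀ g : G, (X ∩ Y.image (fun x => g + x)).card ≤ 1)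

theorem IsCode.map {G G' : Type*} [AddCommGroup G] [DecidableEq G] [AddCommGroup G']
    [DecidableEq G'] (e : G ≃+ G') {F : Finset (Finset G)} (hF : IsCode F) :
    ∃ F' : Finset (Finset G'), IsCode F' ∧ F'.card = F.card := by
  have key : ∀ (X Y : Finset G) (g : G'),
      (X.map e.toEquiv.toEmbedding ∩ (Y.map e.toEquiv.toEmbedding).image (fun x => g + x)).card =
        (X ∩ Y.image (fun x => e.symm g + x)).card := by
    intro X Y g
    rw [← card_map e.toEquiv.toEmbedding (s := X ∩ _), map_inter]
    congr 2
    ext z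
    simp only [mem_image, mem_map]
    constructor
    · rintro ⟨_, ⟨y, hy, rfl⟩, rfl⟩
      exact ⟨_, ⟨y, hy, rfl⟩, by simp⟩
    · rintro ⟨_, ⟨y, hy, rfl⟩, rfl⟩
      exact ⟨_, ⟨y, hy, rfl⟩, by simp⟩
  refine ⟨F.map (mapEmbedding e.toEquiv.toEmbedding).toEmbedding, ⟨?_, ?_, ?_⟩, card_map _⟩
  · intro X hX
    obtain ⟨X, hX', rfl⟩ := mem_map.1 hX
    simpa using hF.1 X hX'
  · intro X hX g hg
    obtain ⟨X, hX', rfl⟩ := mem_map.1 hX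
    have := hF.2.1 X hX' (e.symm g) (by simpa using hg)
    simpa only [RelEmbedding.coe_toEmbedding, mapEmbedding_apply, key] using this
  · intro X hX Y hY hXY g
    obtain ⟨X, hX', rfl⟩ := mem_map.1 hX
    obtain ⟨Y, hY', rfl⟩ := mem_map.1 hY
    have := hF.2.2 X hX' Y hY' (fun h => hXY (by rw [h])) (e.symm g)
    simpa only [RelEmbedding.coe_toEmbedding, mapEmbedding_apply, key] using this

/-- The differences of the triple `{0, a, b}`. -/
def tripleDiffs {G : Type*} [AddCommGroup G] (a b : G) : Set G :=
  {g | g = a ∨ g = -a ∨ g = b ∨ g = -b ∨ g = a - b ∨ g = b - a}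

theorem sub_mem_tripleDiffs {G : Type*} [AddCommGroup G] [DecidableEq G] {a b x y : G}
    (hx : x ∈ ({0, a, b} : Finset G)) (hy : y ∈ ({0, a, b} : Finset G)) (hxy : x ≠ y) :
    x - y ∈ tripleDiffs a b := by
  simp only [mem_insert, mem_singleton] at hx hy
  rcases hx with rfl | rfl | rfl <;> rcases hy with rfl | rfl | rfl <;>
    simp_all [tripleDiffs]

theorem exists_isCode_of_tripleDiffs {G : Type*} [AddCommGroup G] [DecidableEq G] {ι : Type*}
    [Fintype ι] (a b : ι → G) (ha : ∀ i, 3 • a i ≠ 0) (hb : ∀ i, b i ≠ 0)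
    (hab : ∀ i, a i ≠ b i)
    (hdisj : ∀ i j g, g ∈ tripleDiffs (a i) (b i) → g ∈ tripleDiffs (a j) (b j) → i = j) :
    ∃ F : Finset (Finset G), IsCode F ∧ F.card = Fintype.card ι := by
  have ha0 : ∀ i, a i ≠ 0 := fun i h => ha i (by simp [h])
  have hinter : ∀ i j g x y, x ≠ y → x ∈ ({0, a i, b i} : Finset G) →
      y ∈ ({0, a i, b i} : Finset G) → x - g ∈ ({0, a j, b j} : Finset G) →
      y - g ∈ ({0, a j, b j} : Finset G) → i = j := by
    intro i j g x y hxy hx hy hx' hy'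
    have h1 := sub_mem_tripleDiffs hx hy hxy
    have h2 := sub_mem_tripleDiffs hx' hy' (by simpa using hxy)
    rw [sub_sub_sub_cancel_right] at h2
    exact hdisj i j _ h1 h2
  have hcard : ∀ i, ({0, a i, b i} : Finset G).card = 3 := fun i =>
    card_eq_three.2 ⟨0, a i, b i, (ha0 i).symm, (hb i).symm, hab i, rfl⟩
  refine ⟨univ.image fun i => {0, a i, b i}, ⟨?_, ?_, ?_⟩, ?_⟩
  · simpa using hcard
  · simp only [mem_image, mem_univ, true_and, forall_exists_index, forall_apply_eq_imp_iff]
    intro i g hg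
    by_contra! hlt
    have hsub : ({0, a i, b i} : Finset G) ⊆ ({0, a i, b i} : Finset G).image (fun x => g + x) :=
      inter_eq_left.1 (eq_of_subset_of_card_le inter_subset_left (by rw [hcard]; omega))
    have heq := eq_of_subset_of_card_le hsub (by rw [hcard]; exact card_image_le.trans (hcard i).le)
    have hsum : ∑ x ∈ ({0, a i, b i} : Finset G), x =
        3 • g + ∑ x ∈ ({0, a i, b i} : Finset G), x := by
      conv_lhs => rw [heq]
      rw [sum_image (by simp), sum_add_distrib, sum_const, hcard]
    have h3 : 3 • g = 0 := by simpa using hsum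
    have hg1 : g ∈ ({0, a i, b i} : Finset G) := by
      rw [heq]; exact mem_image.2 ⟨0, by simp, by simp⟩
    have hg2 : -g ∈ ({0, a i, b i} : Finset G) := by
      obtain ⟨x, hx, hx0⟩ := mem_image.1 (hsub (show (0 : G) ∈ _ by simp))
      rwa [← eq_neg_of_add_eq_zero_right hx0]
    simp only [mem_insert, mem_singleton, hg, neg_eq_zero, false_or] at hg1 hg2
    rcases hg1 with h | h
    · exact ha i (h ▸ h3)
    rcases hg2 with h' | h'
    · exact ha i (by rw [← h', smul_neg, h3, neg_zero])
    · have h2 : g + g = 0 := by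
        nth_rewrite 1 [h]; rw [← h']; simp
      refine hg ?_
      have : 3 • g = g + g + g := by abel
      rwa [this, h2, zero_add] at h3
  · simp only [mem_image, mem_univ, true_and, forall_exists_index, forall_apply_eq_imp_iff]
    intro i j hij g
    by_contra! hlt
    obtain ⟨x, hx, y, hy, hxy⟩ := one_lt_card.1 hlt
    simp only [mem_inter, mem_image] at hx hy
    obtain ⟨hx, u, hu, hux⟩ := hx
    obtain ⟨hy, v, hv, hvy⟩ := hy
    refine hij ?_
    rw [hinter i j g x y hxy hx hy (by rwa [← hux, add_sub_cancel_left])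
      (by rwa [← hvy, add_sub_cancel_left])]
  · rw [card_image_of_injective, card_univ]
    intro i j (hij : ({0, a i, b i} : Finset G) = {0, a j, b j})
    exact hinter i j 0 0 (a i) (ha0 i).symm (by simp) (by simp) (by simp)
      (by rw [sub_zero, ← hij]; simp)

theorem IsCode.disjoint_differences {G : Type*} [AddCommGroup G] [DecidableEq G]
    {F : Finset (Finset G)} (hF : IsCode F) {X Y : Finset G} (hX : X ∈ F) (hY : Y ∈ F)
    (hXY : X ≠ Y) :
    Disjoint (X.offDiag.image fun p => p.1 - p.2) (Y.offDiag.image fun p => p.1 - p.2) := by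
  rw [Finset.disjoint_left]
  intro d hdX hdY
  obtain ⟨⟨x, x'⟩, hx, rfl⟩ := mem_image.1 hdX
  obtain ⟨⟨y, y'⟩, hy, hd⟩ := mem_image.1 hdY
  rw [mem_offDiag] at hx hy
  simp only at hx hy hd
  have := hF.2.2 X hX Y hY hXY (x - y)
  refine absurd (one_lt_card.2 ⟨x, ?_, x', ?_, hx.2.2⟩) this.not_gt
  · exact mem_inter.2 ⟨hx.1, mem_image.2 ⟨y, hy.1, by simp⟩⟩
  · refine mem_inter.2 ⟨hx.2.1, mem_image.2 ⟨y', hy.2.1, ?_⟩⟩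
    have : x' = x - (y - y') := by rw [hd]; abel
    rw [this]; abel

/-- Weight of a difference in `Z₂² × H`. -/
def diffWeight {H : Type*} [AddCommGroup H] [DecidableEq H]
    (d : (ZMod 2 × ZMod 2) × H) : ℕ :=
  if d.1 = 0 ∨ d.2 = 0 then 2 else 1

section Upper

variable {H : Type*} [AddCommGroup H] [DecidableEq H]

theorem two_le_sum_pair (hH : ∀ x : H, x + x = 0 → x = 0) (d : (ZMod 2 × ZMod 2) × H) :
    2 ≤ ∑ g ∈ {d, -d}, diffWeight g := by
  by_cases h : d = -d
  · have h2 : d.2 = 0 := hH _ (by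
      have := congrArg Prod.snd h
      rw [Prod.snd_neg] at this
      nth_rewrite 1 [this]; simp)
    rw [← h]
    simp [diffWeight, h2]
  · rw [sum_pair h]
    simp only [diffWeight]
    split_ifs <;> omega

theorem four_le_sum_pair (hH : ∀ x : H, x + x = 0 → x = 0) {d : (ZMod 2 × ZMod 2) × H}
    (hd : d ≠ 0) (h0 : d.1 = 0) : 4 ≤ ∑ g ∈ {d, -d}, diffWeight g := by
  have h : d ≠ -d := by
    intro h
    refine hd (Prod.ext h0 (hH _ ?_))
    have := congrArg Prod.snd h
    rw [Prod.snd_neg] at this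
    nth_rewrite 1 [this]; simp
  rw [sum_pair h]
  simp [diffWeight, h0]

omit [DecidableEq H] in
theorem fst_neg_eq (d : (ZMod 2 × ZMod 2) × H) : (-d).1 = d.1 := by
  rw [Prod.fst_neg]
  generalize d.1 = v
  revert v
  decide

theorem disjoint_pair {d e : (ZMod 2 × ZMod 2) × H} (h : d.1 ≠ e.1) :
    Disjoint ({d, -d} : Finset _) {e, -e} := by
  have hd := fst_neg_eq d
  have he := fst_neg_eq e
  rw [Finset.disjoint_left]
  simp only [mem_insert, mem_singleton]
  rintro x (rfl | rfl) (hx | hx) <;> have := congrArg Prod.fst hx <;> simp_all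

theorem six_le_sum_differences (hH : ∀ x : H, x + x = 0 → x = 0)
    {F : Finset (Finset ((ZMod 2 × ZMod 2) × H))} (hF : IsCode F)
    {X : Finset ((ZMod 2 × ZMod 2) × H)} (hX : X ∈ F) :
    6 ≤ ∑ g ∈ X.offDiag.image (fun p => p.1 - p.2), diffWeight g := by
  obtain ⟨x, y, z, hxy, hxz, hyz, rfl⟩ := card_eq_three.1 (hF.1 X hX)
  set D := ({x, y, z} : Finset ((ZMod 2 × ZMod 2) × H)).offDiag.image (fun p => p.1 - p.2)
  obtain ⟨a, rfl⟩ : ∃ a, y = x + a := ⟨y - x, by abel⟩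
  obtain ⟨b, rfl⟩ : ∃ b, z = x + b := ⟨z - x, by abel⟩
  have ha : a ≠ 0 := by rintro rfl; simp at hxy
  have hb : b ≠ 0 := by rintro rfl; simp at hxz
  have hab : a ≠ b := by rintro rfl; simp at hyz
  have hmem : ∀ u v, u ∈ ({x, x + a, x + b} : Finset ((ZMod 2 × ZMod 2) × H)) →
      v ∈ ({x, x + a, x + b} : Finset ((ZMod 2 × ZMod 2) × H)) → u ≠ v → u - v ∈ D :=
    fun u v hu hv huv => mem_image.2 ⟨(u, v), mem_offDiag.2 ⟨hu, hv, huv⟩, rfl⟩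
  have hpair : ∀ u v d, u ∈ ({x, x + a, x + b} : Finset ((ZMod 2 × ZMod 2) × H)) →
      v ∈ ({x, x + a, x + b} : Finset ((ZMod 2 × ZMod 2) × H)) → u - v = d → d ≠ 0 →
      ({d, -d} : Finset _) ⊆ D := by
    rintro u v d hu hv rfl huv
    rw [sub_ne_zero] at huv
    rw [insert_subset_iff, singleton_subset_iff, neg_sub]
    exact ⟨hmem _ _ hu hv huv, hmem _ _ hv hu huv.symm⟩
  have hDa := hpair (x + a) x a (by simp) (by simp) (by abel) ha
  have hDb := hpair (x + b) x b (by simp) (by simp) (by abel) hb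
  have hDc := hpair (x + a) (x + b) (a - b) (by simp) (by simp) (by abel) (sub_ne_zero.2 hab)
  have two : ∀ d e : (ZMod 2 × ZMod 2) × H, d ≠ 0 → d.1 = 0 → e.1 ≠ 0 →
      ({d, -d} : Finset _) ⊆ D → ({e, -e} : Finset _) ⊆ D → 6 ≤ ∑ g ∈ D, diffWeight g := by
    intro d e hd hd0 he hdD heD
    have := sum_le_sum_of_subset (f := diffWeight) (union_subset hdD heD)
    rw [sum_union (disjoint_pair (by rw [hd0]; exact he.symm))] at this
    linarith [four_le_sum_pair hH hd hd0, two_le_sum_pair hH e]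
  by_cases ha1 : a.1 = 0
  · by_cases hb1 : b.1 = 0
    · obtain ⟨c, hc, hca, hcna, hcD⟩ : ∃ c : (ZMod 2 × ZMod 2) × H,
          c.1 = 0 ∧ a ≠ c ∧ -a ≠ c ∧ c ∈ D := by
        by_cases hba : -a = b
        · refine ⟨a - b, by simp [ha1, hb1], ?_, ?_, hDc (by simp)⟩
          · rwa [ne_eq, eq_comm, sub_eq_self]
          · intro h
            refine absurd (hF.2.1 _ hX a ha) ?_
            have h3 : a + b = 0 := by rw [← hba]; abel
            have h4 : a + a = b := by
              rw [← hba] at h ⊢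
              rw [h]; abel
            rw [inter_eq_left.2, card_eq_three.2 ⟨_, _, _, hxy, hxz, hyz, rfl⟩]
            · omega
            · simp only [image_insert, image_singleton, insert_subset_iff, singleton_subset_iff,
                mem_insert, mem_singleton]
              refine ⟨Or.inr (Or.inr ?_), Or.inl (by abel), Or.inr (Or.inl ?_)⟩
              · rw [add_left_comm, h3, add_zero]
              · rw [← h4]; abel
        · exact ⟨b, hb1, hab, hba, hDb (by simp)⟩
      have hane : a ≠ -a := by
        intro h
        refine ha (Prod.ext ha1 (hH _ ?_))
        have := congrArg Prod.snd h
        rw [Prod.snd_neg] at this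
        nth_rewrite 1 [this]; simp
      have hsub : ({a, -a, c} : Finset _) ⊆ D := by
        rw [insert_subset_iff, insert_subset_iff, singleton_subset_iff]
        exact ⟨hDa (by simp), hDa (by simp), hcD⟩
      refine le_trans ?_ (sum_le_sum_of_subset hsub)
      rw [sum_insert (by simp [hane, hca]), sum_pair hcna]
      simp [diffWeight, ha1, hc]
    · exact two a b ha ha1 hb1 hDa hDb
  · by_cases hb1 : b.1 = 0
    · exact two b a hb hb1 ha1 hDb hDa
    · by_cases hc1 : a.1 = b.1
      · exact two (a - b) a (sub_ne_zero.2 hab) (by simp [hc1]) ha1 hDc hDa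
      · have hac : a.1 ≠ (a - b).1 := by
          rwa [Prod.fst_sub, ne_eq, eq_comm, sub_eq_self]
        have hbc : b.1 ≠ (a - b).1 := by
          rw [Prod.fst_sub]
          generalize a.1 = u at *
          generalize b.1 = v at *
          clear * - ha1 hb1
          revert u v
          decide
        have := sum_le_sum_of_subset (f := diffWeight) (union_subset (union_subset hDa hDb) hDc)
        rw [sum_union (disjoint_union_left.2 ⟨disjoint_pair hac, disjoint_pair hbc⟩),
          sum_union (disjoint_pair hc1)] at this
        linarith [two_le_sum_pair hH a, two_le_sum_pair hH b, two_le_sum_pair hH (a - b)]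

theorem sum_diffWeight [Fintype H] :
    ∑ g ∈ univ.erase (0 : (ZMod 2 × ZMod 2) × H), diffWeight g = 5 * Fintype.card H + 1 := by
  have h1 : ∀ v : ZMod 2 × ZMod 2, v ≠ 0 → ∑ x : H, diffWeight (v, x) = Fintype.card H + 1 := by
    intro v hv
    have : ∀ x : H, diffWeight (v, x) = 1 + if x = 0 then 1 else 0 := by
      intro x
      simp only [diffWeight, hv, false_or]
      split_ifs <;> rfl
    simp [this, sum_add_distrib]
  have h0 : ∑ x : H, diffWeight ((0 : ZMod 2 × ZMod 2), x) = 2 * Fintype.card H := by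
    simp [diffWeight, mul_comm]
  have htot : ∑ g : (ZMod 2 × ZMod 2) × H, diffWeight g = 5 * Fintype.card H + 3 := by
    rw [Fintype.sum_prod_type, ← add_sum_erase _ _ (mem_univ (0 : ZMod 2 × ZMod 2)), h0,
      sum_congr rfl (fun v hv => h1 v (ne_of_mem_erase hv)), sum_const]
    have : (univ.erase (0 : ZMod 2 × ZMod 2)).card = 3 := by decide
    rw [this]
    simp only [smul_eq_mul]
    ring
  rw [← add_sum_erase _ _ (mem_univ (0 : (ZMod 2 × ZMod 2) × H))] at htot
  have : diffWeight (0 : (ZMod 2 × ZMod 2) × H) = 2 := by simp [diffWeight]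
  omega

theorem IsCode.card_le [Fintype H] (hH : ∀ x : H, x + x = 0 → x = 0)
    {F : Finset (Finset ((ZMod 2 × ZMod 2) × H))} (hF : IsCode F) :
    6 * F.card ≤ 5 * Fintype.card H + 1 := by
  rw [← sum_diffWeight, mul_comm, ← smul_eq_mul]
  refine (card_nsmul_le_sum F _ 6 fun X hX => six_le_sum_differences hH hF hX).trans ?_
  rw [← sum_biUnion fun X hX Y hY hXY => hF.disjoint_differences hX hY hXY]
  refine sum_le_sum_of_subset fun d hd => ?_
  obtain ⟨X, -, hd⟩ := mem_biUnion.1 hd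
  obtain ⟨p, hp, rfl⟩ := mem_image.1 hd
  simpa [sub_eq_zero] using (mem_offDiag.1 hp).2.2

end Upper

section Configuration

variable {H : Type*} [AddCommGroup H]

/-- Data producing triples in `Z₂² × H`: a pair `(i, y)` stands for a triple with differences
`±(cᵢ, y)` and `±(0, 2y)`, and `t` for one with differences `±(cᵢ, tᵢ)`, where `c₀, c₁, c₂` are the
involutions of `Z₂²`. -/
structure IsConfig (D : Set H) (Y : Finset (Fin 3 × H)) (T : Finset (Fin 3 → H)) : Prop where
  mem_left : ∀ p ∈ Y, p.2 ∈ D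
  mem_right : ∀ t ∈ T, ∀ i, t i ∈ D
  ne_zero : ∀ p ∈ Y, p.2 ≠ 0
  sum_eq_zero : ∀ t ∈ T, t 0 + t 1 + t 2 = 0
  inj_left : ∀ p ∈ Y, ∀ q ∈ Y, p.2 = q.2 ∨ p.2 = -q.2 → p = q
  inj_right : ∀ t ∈ T, ∀ u ∈ T, ∀ i, t i = u i ∨ t i = -u i → t = u
  disj : ∀ p ∈ Y, ∀ t ∈ T, ¬(t p.1 = p.2 ∨ t p.1 = -p.2)

/-- The three involutions of `Z₂²`. -/
def involution : Fin 3 → ZMod 2 × ZMod 2 := ![(1, 0), (0, 1), (1, 1)]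

theorem involution_injective : Function.Injective involution := by decide

theorem involution_ne_zero : ∀ i, involution i ≠ 0 := by decide

theorem neg_involution : ∀ i, -involution i = involution i := by decide

theorem mem_tripleDiffs_left {i : Fin 3} {y : H} {g : (ZMod 2 × ZMod 2) × H}
    (hg : g ∈ tripleDiffs (involution i, y) (-(involution i, y))) :
    (g.1 = involution i ∧ (g.2 = y ∨ g.2 = -y)) ∨
      (g.1 = 0 ∧ (g.2 = y + y ∨ g.2 = -(y + y))) := by
  have h0 : ∀ i, involution i + involution i = 0 := by decide
  rcases hg with rfl | rfl | rfl | rfl | rfl | rfl <;>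
    simp [neg_involution, h0, sub_eq_add_neg]

theorem mem_tripleDiffs_right {t : Fin 3 → H} (ht : t 0 + t 1 + t 2 = 0)
    {g : (ZMod 2 × ZMod 2) × H}
    (hg : g ∈ tripleDiffs (involution 0, t 0) (-(involution 1, t 1))) :
    ∃ i, g.1 = involution i ∧ (g.2 = t i ∨ g.2 = -t i) := by
  have h2 : t 2 = -(t 0 + t 1) := eq_neg_of_add_eq_zero_right ht
  rcases hg with rfl | rfl | rfl | rfl | rfl | rfl
  · exact ⟨0, rfl, Or.inl rfl⟩
  · exact ⟨0, neg_involution 0, Or.inr rfl⟩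
  · exact ⟨1, neg_involution 1, Or.inr rfl⟩
  · exact ⟨1, by rw [neg_neg], Or.inl (by rw [neg_neg])⟩
  · exact ⟨2, by simp only [Prod.fst_sub, Prod.fst_neg]; decide, Or.inr (by simp [h2])⟩
  · exact ⟨2, by simp only [Prod.fst_sub, Prod.fst_neg]; decide, Or.inl (by simp [h2]; abel)⟩

theorem eq_or_eq_neg_of_double (hH : ∀ x : H, x + x = 0 → x = 0) {g y z : H}
    (hy : g = y + y ∨ g = -(y + y)) (hz : g = z + z ∨ g = -(z + z)) : y = z ∨ y = -z := by
  have key : ∀ u v : H, u + u = v + v → u = v := fun u v h =>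
    sub_eq_zero.1 (hH _ (by rw [sub_add_sub_comm, h, sub_self]))
  rcases hy with rfl | rfl <;> rcases hz with hz | hz
  · exact Or.inl (key _ _ hz)
  · exact Or.inr (key _ _ (by rw [hz]; abel))
  · exact Or.inr (key _ _ (by rw [← neg_add, ← hz, neg_neg]))
  · exact Or.inl (key _ _ (neg_injective hz))

theorem eq_or_eq_neg_of_common {g y z : H} (hy : g = y ∨ g = -y) (hz : g = z ∨ g = -z) :
    y = z ∨ y = -z := by
  rcases hy with rfl | rfl <;> rcases hz with hz | hz
  · exact Or.inl hz
  · exact Or.inr hz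
  · exact Or.inr (by rw [← hz, neg_neg])
  · exact Or.inl (neg_injective hz)

theorem IsConfig.exists_isCode [DecidableEq H] (hH : ∀ x : H, x + x = 0 → x = 0) {D : Set H}
    {Y : Finset (Fin 3 × H)} {T : Finset (Fin 3 → H)} (h : IsConfig D Y T) :
    ∃ F : Finset (Finset ((ZMod 2 × ZMod 2) × H)), IsCode F ∧ F.card = Y.card + T.card := by
  let a : Y ⊕ T → (ZMod 2 × ZMod 2) × H :=
    Sum.elim (fun p => (involution p.1.1, p.1.2)) (fun t => (involution 0, t.1 0))
  let b : Y ⊕ T → (ZMod 2 × ZMod 2) × H :=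
    Sum.elim (fun p => -(involution p.1.1, p.1.2)) (fun t => -(involution 1, t.1 1))
  have hdisj : ∀ i j g, g ∈ tripleDiffs (a i) (b i) → g ∈ tripleDiffs (a j) (b j) → i = j := by
    have hYT : ∀ (p : Y) (t : T) g, g ∈ tripleDiffs (a (.inl p)) (b (.inl p)) →
        g ∈ tripleDiffs (a (.inr t)) (b (.inr t)) → False := by
      intro p t g hp ht
      obtain ⟨i, hi, hit⟩ := mem_tripleDiffs_right (h.sum_eq_zero _ t.2) ht
      rcases mem_tripleDiffs_left hp with ⟨hp1, hp2⟩ | ⟨hp1, -⟩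
      · obtain rfl : i = p.1.1 := involution_injective (hi.symm.trans hp1)
        exact h.disj _ p.2 _ t.2 (eq_or_eq_neg_of_common hit hp2)
      · exact involution_ne_zero i (hi.symm.trans hp1)
    rintro (p | t) (q | u) g hi hj
    · congr 1
      refine Subtype.ext (h.inj_left _ p.2 _ q.2 ?_)
      rcases mem_tripleDiffs_left hi with ⟨hp1, hp2⟩ | ⟨hp1, hp2⟩ <;>
        rcases mem_tripleDiffs_left hj with ⟨hq1, hq2⟩ | ⟨hq1, hq2⟩
      · exact eq_or_eq_neg_of_common hp2 hq2
      · exact absurd (hp1.symm.trans hq1) (involution_ne_zero _)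
      · exact absurd (hq1.symm.trans hp1) (involution_ne_zero _)
      · exact eq_or_eq_neg_of_double hH hp2 hq2
    · exact (hYT p u g hi hj).elim
    · exact (hYT q t g hj hi).elim
    · congr 1
      obtain ⟨i, hi1, hi2⟩ := mem_tripleDiffs_right (h.sum_eq_zero _ t.2) hi
      obtain ⟨j, hj1, hj2⟩ := mem_tripleDiffs_right (h.sum_eq_zero _ u.2) hj
      obtain rfl : i = j := involution_injective (hi1.symm.trans hj1)
      exact Subtype.ext (h.inj_right _ t.2 _ u.2 i (eq_or_eq_neg_of_common hi2 hj2))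
  have ha : ∀ i, 3 • a i ≠ 0 := by
    have h3 : ∀ i, 3 • involution i ≠ 0 := by decide
    rintro (p | t) h0
    · exact h3 _ (congrArg Prod.fst h0)
    · exact h3 _ (congrArg Prod.fst h0)
  have hb : ∀ i, b i ≠ 0 := by
    rintro (p | t) h0
    · exact involution_ne_zero p.1.1 (congrArg Prod.fst (neg_eq_zero.1 h0))
    · exact involution_ne_zero 1 (congrArg Prod.fst (neg_eq_zero.1 h0))
  have hab : ∀ i, a i ≠ b i := by
    rintro (p | t) h0
    · refine h.ne_zero _ p.2 (hH _ ?_)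
      have : p.1.2 = -p.1.2 := congrArg Prod.snd h0
      nth_rewrite 1 [this]
      simp
    · have : involution 0 ≠ -involution 1 := by decide
      exact this (congrArg Prod.fst h0)
  obtain ⟨F, hF, hcard⟩ := exists_isCode_of_tripleDiffs a b ha hb hab hdisj
  exact ⟨F, hF, by simpa using hcard⟩

theorem IsConfig.map {K : Type*} [AddCommGroup K] {D : Set K} {Y : Finset (Fin 3 × K)}
    {T : Finset (Fin 3 → K)} (h : IsConfig D Y T) (j : K →+ H) (hj : Function.Injective j) :
    ∃ Y' T', IsConfig (H := H) (Set.range j) Y' T' ∧ Y'.card = Y.card ∧ T'.card = T.card := by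
  have hiff : ∀ x y : K, j x = j y ∨ j x = -j y ↔ x = y ∨ x = -y := fun x y => by
    rw [← map_neg, hj.eq_iff, hj.eq_iff]
  refine ⟨Y.map ⟨Prod.map id j, Function.injective_id.prodMap hj⟩,
    T.map ⟨fun t => j ∘ t, hj.comp_left⟩, ⟨?_, ?_, ?_, ?_, ?_, ?_, ?_⟩, card_map _, card_map _⟩
  all_goals simp only [mem_map, Function.Embedding.coeFn_mk, forall_exists_index, and_imp,
    forall_apply_eq_imp_iff₂, Prod.map_snd, Prod.map_fst, Function.comp_apply, id, hiff]
  · exact fun p _ => ⟨_, rfl⟩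
  · exact fun t _ i => ⟨_, rfl⟩
  · exact fun p hp => by simpa using (map_ne_zero_iff j hj).2 (h.ne_zero p hp)
  · exact fun t ht => by rw [← map_add, ← map_add, h.sum_eq_zero t ht, map_zero]
  · exact fun p hp q hq hpq => by rw [h.inj_left p hp q hq hpq]
  · exact fun t ht u hu i htu => by rw [h.inj_right t ht u hu i htu]
  · exact h.disj

theorem IsConfig.union [DecidableEq H] {D D' : Set H} {Y Y' : Finset (Fin 3 × H)}
    {T T' : Finset (Fin 3 → H)} (h : IsConfig D Y T) (h' : IsConfig D' Y' T')
    (hD : ∀ x ∈ D, ∀ y ∈ D', ¬(x = y ∨ x = -y)) :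
    IsConfig Set.univ (Y ∪ Y') (T ∪ T') ∧
      (Y ∪ Y').card = Y.card + Y'.card ∧ (T ∪ T').card = T.card + T'.card := by
  have hD' : ∀ x ∈ D, ∀ y ∈ D', ¬(y = x ∨ y = -x) := fun x hx y hy hxy =>
    hD x hx y hy (hxy.imp Eq.symm fun h => by rw [h, neg_neg])
  refine ⟨⟨fun _ _ => trivial, fun _ _ _ => trivial, ?_, ?_, ?_, ?_, ?_⟩, card_union_of_disjoint ?_,
    card_union_of_disjoint ?_⟩
  · exact fun p hp => (mem_union.1 hp).elim (h.ne_zero p) (h'.ne_zero p)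
  · exact fun t ht => (mem_union.1 ht).elim (h.sum_eq_zero t) (h'.sum_eq_zero t)
  · intro p hp q hq hpq
    rcases mem_union.1 hp with hp | hp <;> rcases mem_union.1 hq with hq | hq
    · exact h.inj_left p hp q hq hpq
    · exact (hD _ (h.mem_left p hp) _ (h'.mem_left q hq) hpq).elim
    · exact (hD' _ (h.mem_left q hq) _ (h'.mem_left p hp) hpq).elim
    · exact h'.inj_left p hp q hq hpq
  · intro t ht u hu i htu
    rcases mem_union.1 ht with ht | ht <;> rcases mem_union.1 hu with hu | hu
    · exact h.inj_right t ht u hu i htu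
    · exact (hD _ (h.mem_right t ht i) _ (h'.mem_right u hu i) htu).elim
    · exact (hD' _ (h.mem_right u hu i) _ (h'.mem_right t ht i) htu).elim
    · exact h'.inj_right t ht u hu i htu
  · intro p hp t ht hpt
    rcases mem_union.1 hp with hp | hp <;> rcases mem_union.1 ht with ht | ht
    · exact h.disj p hp t ht hpt
    · exact hD' _ (h.mem_left p hp) _ (h'.mem_right t ht _) hpt
    · exact hD _ (h.mem_right t ht _) _ (h'.mem_left p hp) hpt
    · exact h'.disj p hp t ht hpt
  · rw [Finset.disjoint_left]
    exact fun p hp hp' => hD _ (h.mem_left p hp) _ (h'.mem_left p hp') (Or.inl rfl)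
  · rw [Finset.disjoint_left]
    exact fun t ht ht' => hD _ (h.mem_right t ht 0) _ (h'.mem_right t ht' 0) (Or.inl rfl)

end Configuration

section Cyclic

theorem natCast_eq_or_eq_neg {n x y : ℕ} (hx : x < n) (hy : y < n)
    (h : (x : ZMod n) = y ∨ (x : ZMod n) = -y) : x = y ∨ x + y = 0 ∨ x + y = n := by
  rcases h with h | h
  · rw [ZMod.natCast_eq_natCast_iff'] at h
    rw [Nat.mod_eq_of_lt hx, Nat.mod_eq_of_lt hy] at h
    exact Or.inl h
  · rw [eq_neg_iff_add_eq_zero, ← Nat.cast_add, ZMod.natCast_eq_zero_iff] at h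
    obtain ⟨c, hc⟩ := h
    have : c < 2 := by
      by_contra! h2
      have := Nat.mul_le_mul_left n h2
      omega
    interval_cases c <;> omega

/-- Absolute values of the entries of the sum-zero triples used in cyclic groups. -/
def cyclicAbs (k s : ℕ) : Fin 3 → ℕ :=
  if s = 0 then ![0, 0, 0] else if s ≤ k then ![k + s, s, k + 2 * s]
  else ![2 * k + 1 - s, k + s, 2 * s - k - 1]

/-- The sum-zero triples used in cyclic groups. -/
def cyclicTriple (n k s : ℕ) : Fin 3 → ZMod n := fun i =>
  if (if s ≤ k then 2 else 1) = i then -(cyclicAbs k s i : ZMod n) else cyclicAbs k s i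

/-- The involution attached to an element of a cyclic group. -/
def cyclicColor (k y : ℕ) : Fin 3 := if y ≤ k then 2 else if y ≤ 2 * k then 1 else 0

theorem exists_isConfig_zmod {n : ℕ} (hn : n % 2 = 1) :
    ∃ Y T, IsConfig (H := ZMod n) Set.univ Y T ∧ Y.card + T.card = (5 * n + 1) / 6 := by
  obtain ⟨k, hk⟩ : ∃ k, k = (n + 1) / 6 := ⟨_, rfl⟩
  obtain ⟨N, hN⟩ : ∃ N, N = (n - 1) / 2 := ⟨_, rfl⟩
  obtain ⟨M, hM⟩ : ∃ M, M = 1 + k + min k (N - 2 * k) := ⟨_, rfl⟩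
  have hcast : ∀ {x y z w : ZMod n}, (x = z ∨ x = -z) → (y = w ∨ y = -w) →
      (x = y ∨ x = -y) → (z = w ∨ z = -w) := by
    rintro x y z w (rfl | rfl) (rfl | rfl) (h | h)
    · exact Or.inl h
    · exact Or.inr h
    · exact Or.inr h
    · exact Or.inl (by rw [h, neg_neg])
    · exact Or.inr (by rw [← h, neg_neg])
    · exact Or.inl (neg_injective h)
    · exact Or.inl (neg_injective h)
    · exact Or.inr (neg_injective h)
  have htriple : ∀ s i, cyclicTriple n k s i = cyclicAbs k s i ∨
      cyclicTriple n k s i = -cyclicAbs k s i := by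
    intro s i
    unfold cyclicTriple
    split_ifs
    exacts [Or.inr rfl, Or.inl rfl, Or.inr rfl, Or.inl rfl]
  have habs_lt : ∀ s < M, ∀ i, cyclicAbs k s i < n := by
    intro s hs i
    unfold cyclicAbs
    fin_cases i <;> split_ifs <;> simp <;> omega
  have hY : ∀ x ∈ Icc 1 N, ∀ y ∈ Icc 1 N, ((x : ZMod n) = y ∨ (x : ZMod n) = -y) → x = y := by
    intro x hx y hy h
    rw [mem_Icc] at hx hy
    have := natCast_eq_or_eq_neg (by omega) (by omega) h
    omega
  have hT : ∀ s ∈ range M, ∀ u ∈ range M, ∀ i,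
      (cyclicTriple n k s i = cyclicTriple n k u i ∨
        cyclicTriple n k s i = -cyclicTriple n k u i) → s = u := by
    intro s hs u hu i h
    rw [mem_range] at hs hu
    have := natCast_eq_or_eq_neg (habs_lt s hs i) (habs_lt u hu i)
      (hcast (htriple s i) (htriple u i) h)
    unfold cyclicAbs at this
    fin_cases i <;> split_ifs at this <;> simp at this <;> omega
  refine ⟨(Icc 1 N).image fun y => (cyclicColor k y, (y : ZMod n)),
    (range M).image (cyclicTriple n k), ⟨fun _ _ => trivial, fun _ _ _ => trivial, ?_, ?_, ?_, ?_,
      ?_⟩, ?_⟩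
  · simp only [mem_image, forall_exists_index, and_imp, forall_apply_eq_imp_iff₂]
    intro y hy h
    rw [mem_Icc] at hy
    rw [ZMod.natCast_eq_zero_iff] at h
    have := Nat.le_of_dvd (by omega) h
    omega
  · simp only [mem_image, forall_exists_index, and_imp, forall_apply_eq_imp_iff₂, mem_range]
    intro s hs
    unfold cyclicTriple cyclicAbs
    by_cases h0 : s = 0
    · simp [h0]
    by_cases h1 : s ≤ k
    · simp [h0, h1]
      ring
    · have h2 : s ≤ 2 * k + 1 := by omega
      have h3 : k + 1 ≤ 2 * s := by omega
      simp [h0, h1, Nat.sub_sub, Nat.cast_sub h2, Nat.cast_sub h3]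
      ring
  · simp only [mem_image, forall_exists_index, and_imp, forall_apply_eq_imp_iff₂]
    intro x hx y hy h
    rw [hY x hx y hy h]
  · simp only [mem_image, forall_exists_index, and_imp, forall_apply_eq_imp_iff₂]
    intro s hs u hu i h
    rw [hT s hs u hu i h]
  · simp only [mem_image, forall_exists_index, and_imp, forall_apply_eq_imp_iff₂]
    intro y hy s hs h
    rw [mem_Icc] at hy
    rw [mem_range] at hs
    have := natCast_eq_or_eq_neg (habs_lt s hs _) (by omega)
      (hcast (htriple s _) (Or.inl rfl) h)
    unfold cyclicAbs cyclicColor at this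
    split_ifs at this <;> simp at this <;> omega
  · rw [card_image_of_injOn, card_image_of_injOn]
    · simp only [Nat.card_Icc, card_range]
      omega
    · exact fun s hs u hu h => hT s hs u hu 0 (Or.inl (congrFun h 0))
    · exact fun x hx y hy h => hY x hx y hy (Or.inl (congrArg Prod.snd h))

end Cyclic

section Rotation

variable {H : Type*} [AddCommGroup H] [Fintype H] [DecidableEq H]

omit [DecidableEq H] in
theorem two_mul_card_filter_lt_neg (hH : ∀ x : H, x + x = 0 → x = 0) {E : H → ℕ}
    (hE : Function.Injective E) (P : H → Prop) [DecidablePred P] (hP : ∀ h, P (-h) ↔ P h)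
    (h0 : ¬P 0) :
    2 * #{h | P h ∧ E h < E (-h)} = #{h | P h} := by
  have h1 : #{h | P h ∧ E h < E (-h)} = #{h | P h ∧ ¬E h < E (-h)} := by
    refine card_bij (fun h _ => -h) ?_ (fun _ _ _ _ h => neg_injective h) ?_
    · simp only [mem_filter, mem_univ, true_and, hP, neg_neg]
      exact fun h hh => ⟨hh.1, hh.2.not_gt⟩
    · simp only [mem_filter, mem_univ, true_and]
      refine fun h hh => ⟨-h, ⟨(hP h).2 hh.1, ?_⟩, neg_neg h⟩
      rw [neg_neg]
      refine lt_of_le_of_ne (not_lt.1 hh.2) fun he => h0 ?_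
      have : -h = h := hE he
      rw [← hH h (by nth_rewrite 1 [← this]; simp)]
      exact hh.1
  have := card_filter_add_card_filter_not (s := univ.filter fun h => P h) (fun h => E h < E (-h))
  rw [filter_filter, filter_filter] at this
  omega

omit [Fintype H] [DecidableEq H] in
theorem exists_rotation_coloring [Countable H] (w : H →+ H)
    (hw : ∀ q, q + w q + w (w q) = 0) :
    ∃ f : H → Fin 3, (∀ q, f (-q) = f q) ∧ ∀ q, w q ≠ q → f (w q) = f q + 1 := by
  obtain ⟨e, he⟩ := Countable.exists_injective_nat H
  obtain ⟨S, hS⟩ : ∃ S : H → ℕ, ∀ q, S q = min (e q) (e (-q)) := ⟨_, fun _ => rfl⟩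
  have hSneg : ∀ q, S (-q) = S q := fun q => by rw [hS, hS, neg_neg, min_comm]
  have hSeq : ∀ q r, S q = S r → q = r ∨ q = -r := by
    intro q r h
    rw [hS, hS] at h
    rcases min_choice (e q) (e (-q)) with h1 | h1 <;>
      rcases min_choice (e r) (e (-r)) with h2 | h2 <;> rw [h1, h2] at h <;> have h := he h
    · exact Or.inl h
    · exact Or.inr h
    · exact Or.inr (by rw [← h, neg_neg])
    · exact Or.inl (neg_injective h)
  have hw3 : ∀ q, w (w (w q)) = q := by
    intro q
    have h1 := hw q
    have h2 := hw (w q)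
    rw [← h1, add_assoc q, add_comm q] at h2
    exact add_left_cancel h2
  have hne : ∀ q, w q ≠ q → S q ≠ S (w q) := by
    intro q hq h
    rcases hSeq _ _ h with h | h
    · exact hq h.symm
    · have h1 : w q = -q := by rw [h, neg_neg]; exact congrArg w h.symm
      have := hw q
      rw [h1, map_neg, h1] at this
      have hq0 : q = 0 := by simpa using this
      exact hq (by rw [hq0, map_zero])
  refine ⟨fun q => if S q < S (w q) ∧ S q < S (w (w q)) then 0 else
    if S (w q) < S q ∧ S (w q) < S (w (w q)) then 2 else 1, ?_, ?_⟩
  · intro q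
    simp only [map_neg, hSneg]
  · intro q hq
    have h1 := hne q hq
    have hq' : w (w q) ≠ w q := fun h => hq (by
      have := congrArg (fun x => w (w x)) h
      simpa only [hw3] using this)
    have h2 := hne (w q) hq'
    have h3 : S (w (w q)) ≠ S q := by
      have := hne (w (w q)) (by rw [hw3]; exact fun h => hq (by rw [h, hw3, ← h]))
      rwa [hw3] at this
    simp only [hw3]
    split_ifs <;> first | rfl | omega

theorem exists_isConfig_of_rotation {R : Type*} [AddCommGroup R] [Countable R] [DecidableEq R]
    (hH : ∀ x : H, x + x = 0 → x = 0) (π : H →+ R) (s : R → H) (hs : ∀ q, π (s q) = q)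
    (hsneg : ∀ q, s (-q) = -s q) (w : R →+ R) (hw : ∀ q, q + w q + w (w q) = 0) :
    ∃ Y T, IsConfig {h : H | w (π h) ≠ π h} Y T ∧
      6 * (Y.card + T.card) = 5 * #{h : H | w (π h) ≠ π h} := by
  obtain ⟨f, hfneg, hf⟩ := exists_rotation_coloring w hw
  obtain ⟨E, hE⟩ := Countable.exists_injective_nat H
  obtain ⟨φ, hφ⟩ : ∃ φ : H → H, ∀ h, φ h = h - s (π h) + s (w (π h)) := ⟨_, fun _ => rfl⟩
  have hπφ : ∀ h, π (φ h) = w (π h) := fun h => by simp [hφ, hs]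
  have hφneg : ∀ h, φ (-h) = -φ h := fun h => by
    rw [hφ, hφ, map_neg, map_neg, hsneg, hsneg]; abel
  have hww : ∀ q, w (w q) = -q - w q := fun q => by
    rw [← sub_eq_zero, ← hw q]; abel
  have hwinj : ∀ q r, w q = w r → q = r := fun q r h => by
    have h1 := hww q
    rw [h, hww r] at h1
    simpa using h1.symm
  have hφinj : ∀ h h', φ h = φ h' → h = h' := by
    intro h h' heq
    have h1 : π h = π h' := hwinj _ _ (by rw [← hπφ, heq, hπφ])
    rw [hφ, hφ, h1] at heq
    simpa using heq
  have hψinj : ∀ h h', -h - φ h = -h' - φ h' → h = h' := by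
    intro h h' heq
    have h1 : π h = π h' := by
      have := congrArg π heq
      rw [map_sub, map_sub, map_neg, map_neg, hπφ, hπφ, ← hww, ← hww] at this
      exact hwinj _ _ (hwinj _ _ this)
    rw [hφ, hφ, h1] at heq
    refine sub_eq_zero.1 (hH _ ?_)
    rw [← sub_eq_zero] at heq
    rw [← neg_eq_zero, ← heq]
    abel
  obtain ⟨τ, hτ⟩ : ∃ τ : H → Fin 3 → H, ∀ h, τ h = ![h, φ h, -h - φ h] := ⟨_, fun _ => rfl⟩
  have hτneg : ∀ h i, τ (-h) i = -τ h i := by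
    intro h i
    rw [hτ, hτ]
    fin_cases i <;> simp [hφneg]
    abel
  have hτinj : ∀ h h' i, τ h i = τ h' i → h = h' := by
    intro h h' i
    rw [hτ, hτ]
    fin_cases i
    · exact fun h => h
    · exact hφinj h h'
    · exact hψinj h h'
  have hD2 : ∀ q, w q ≠ q → w (w q) ≠ w q := fun q hq h => hq (hwinj _ _ h)
  have hτD : ∀ h, w (π h) ≠ π h → ∀ i, w (π (τ h i)) ≠ π (τ h i) ∧ f (π (τ h i)) = f (π h) + i := by
    intro h hh i
    rw [hτ]
    fin_cases i
    · exact ⟨hh, (add_zero _).symm⟩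
    · refine ⟨?_, ?_⟩
      · simpa [hπφ] using hD2 _ hh
      · simpa [hπφ] using hf _ hh
    · have h2 : π (-h - φ h) = w (w (π h)) := by
        rw [map_sub, map_neg, hπφ, ← hww]
      simp only [Fin.reduceFinMk, Matrix.cons_val, h2]
      refine ⟨hD2 _ (hD2 _ hh), ?_⟩
      rw [hf _ (hD2 _ hh), hf _ hh, add_assoc]
      rfl
  have hpos : ∀ x y, E x < E (-x) → E y < E (-y) → x = y ∨ x = -y → x = y := by
    rintro x y hx hy (h | rfl)
    · exact h
    · rw [neg_neg] at hx
      omega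
  have hτpos : ∀ x y i, E x < E (-x) → E y < E (-y) → τ x i = τ y i ∨ τ x i = -τ y i → x = y :=
    fun x y i hx hy h => hpos x y hx hy (h.imp (hτinj x y i) fun h =>
      hτinj x (-y) i (by rw [h, hτneg]))
  refine ⟨(univ.filter fun h => w (π h) ≠ π h ∧ E h < E (-h)).image fun h => (f (π h), h),
    (univ.filter fun h => (w (π h) ≠ π h ∧ f (π h) ≠ 0) ∧ E h < E (-h)).image τ,
    ⟨?_, ?_, ?_, ?_, ?_, ?_, ?_⟩, ?_⟩
  all_goals try simp only [forall_mem_image, mem_filter, mem_univ, true_and, and_imp]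
  · exact fun h hh _ => hh
  · exact fun h hh _ _ i => (hτD h hh i).1
  · rintro h hh - rfl
    simp at hh
  · intro h _ _ _
    rw [hτ]
    simp
  · intro x _ hx y _ hy h
    rw [hpos x y hx hy h]
  · intro x _ _ hx y _ _ hy i h
    rw [hτpos x y i hx hy h]
  · intro y _ _ h hh hf0 _ heq
    have h1 := (hτD h hh (f (π y))).2
    have h2 : f (π (τ h (f (π y)))) = f (π y) := by
      rcases heq with heq | heq
      · rw [heq]
      · rw [heq, map_neg, hfneg]
    rw [h2] at h1
    exact hf0 (by simpa using h1)
  · have hle : ∀ c, #{h : H | w (π h) ≠ π h ∧ f (π h) = c} ≤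
        #{h : H | w (π h) ≠ π h ∧ f (π h) = c + 1} := by
      intro c
      refine card_le_card_of_injOn φ ?_ fun h _ h' _ => hφinj h h'
      intro h hh
      simp only [coe_filter, mem_univ, true_and, Set.mem_ofPred_eq, hπφ] at hh ⊢
      exact ⟨hD2 _ hh.1, by rw [hf _ hh.1, hh.2]⟩
    have hsplit : ∀ f0 : H → Fin 3, #{h : H | w (π h) ≠ π h} =
        ∑ c, #{h : H | w (π h) ≠ π h ∧ f0 h = c} := by
      intro f0
      rw [card_eq_sum_card_fiberwise (f := f0) (t := univ) fun _ _ => mem_coe.2 (mem_univ _)]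
      simp only [filter_filter]
    have h3 := hsplit fun h => f (π h)
    rw [Fin.sum_univ_three] at h3
    have hne : #{h : H | w (π h) ≠ π h ∧ f (π h) ≠ 0} + #{h : H | w (π h) ≠ π h ∧ f (π h) = 0} =
        #{h : H | w (π h) ≠ π h} := by
      rw [← filter_filter, ← filter_filter, add_comm]
      exact card_filter_add_card_filter_not _
    have hle0 := hle 0
    have hle1 := hle 1
    have hle2 := hle 2
    simp only [zero_add, show (1 : Fin 3) + 1 = 2 from rfl, show (2 : Fin 3) + 1 = 0 from rfl]
      at hle0 hle1 hle2
    have hY := two_mul_card_filter_lt_neg hH hE (fun h => w (π h) ≠ π h) (by simp) (by simp)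
    have hT := two_mul_card_filter_lt_neg hH hE (fun h => w (π h) ≠ π h ∧ f (π h) ≠ 0)
      (by simp [hfneg]) (by simp)
    rw [card_image_of_injective _ fun x y h => congrArg Prod.snd h,
      card_image_of_injective _ fun x y h => hτinj x y 0 (congrFun h 0)]
    omega

end Rotation

section Product

variable {a b : ℕ}

theorem eq_zero_of_add_self_zmod (ha : a % 2 = 1) (x : ZMod a) (h : x + x = 0) : x = 0 := by
  have hu : IsUnit ((2 : ℕ) : ZMod a) :=
    (ZMod.isUnit_iff_coprime 2 a).2 ((Nat.coprime_two_left).2 (Nat.odd_iff.2 ha))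
  rw [← two_mul] at h
  exact (hu.mul_right_eq_zero).1 (by simpa using h)

theorem eq_zero_of_add_self_prod (ha : a % 2 = 1) (hb : b % 2 = 1) (x : ZMod a × ZMod b)
    (h : x + x = 0) : x = 0 :=
  Prod.ext (eq_zero_of_add_self_zmod ha _ (congrArg Prod.fst h))
    (eq_zero_of_add_self_zmod hb _ (congrArg Prod.snd h))

/-- An automorphism `w` of `Z_g × Z_g` with `1 + w + w² = 0`. -/
def hexRotation (g : ℕ) : ZMod g × ZMod g →+ ZMod g × ZMod g :=
  AddMonoidHom.mk' (fun q => (-q.2, q.1 - q.2)) fun p q => by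
    ext <;> simp <;> abel

theorem hexRotation_apply {g : ℕ} (q : ZMod g × ZMod g) : hexRotation g q = (-q.2, q.1 - q.2) := rfl

/-- The reduction `Z_a × Z_b → Z_g × Z_g` with `g = gcd(a, b)`. -/
def reduction (a b : ℕ) : ZMod a × ZMod b →+ ZMod (a.gcd b) × ZMod (a.gcd b) :=
  (ZMod.castHom (Nat.gcd_dvd_left a b) _).toAddMonoidHom.prodMap
    (ZMod.castHom (Nat.gcd_dvd_right a b) _).toAddMonoidHom

theorem reduction_intCast (u v : ℤ) : reduction a b ((u : ZMod a), (v : ZMod b)) =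
    ((u : ZMod (a.gcd b)), (v : ZMod (a.gcd b))) := by
  simp [reduction]

theorem mem_zmultiples_of_rotation_eq {h : ZMod a × ZMod b}
    (hh : hexRotation _ (reduction a b h) = reduction a b h) :
    h ∈ AddSubgroup.zmultiples ((1, -1) : ZMod a × ZMod b) := by
  obtain ⟨x, y⟩ := h
  obtain ⟨u, rfl⟩ := ZMod.intCast_surjective x
  obtain ⟨v, rfl⟩ := ZMod.intCast_surjective y
  rw [reduction_intCast, hexRotation_apply] at hh
  have h1 : ((-v : ℤ) : ZMod (a.gcd b)) = u := by simpa using congrArg Prod.fst hh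
  rw [ZMod.intCast_eq_intCast_iff_dvd_sub, sub_neg_eq_add] at h1
  obtain ⟨c, hc⟩ := h1
  rw [Nat.gcd_eq_gcd_ab] at hc
  refine AddSubgroup.mem_zmultiples_iff.2 ⟨u - a * (a.gcdA b * c), ?_⟩
  ext
  · simp
  · have : u - a * (a.gcdA b * c) = -v + b * (a.gcdB b * c) := by linarith
    rw [this]
    simp

theorem exists_isConfig_prod (ha : a % 2 = 1) (hb : b % 2 = 1) :
    ∃ Y T, IsConfig (H := ZMod a × ZMod b) Set.univ Y T ∧
      Y.card + T.card = (5 * (a * b) + 1) / 6 := by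
  have : NeZero a := ⟨by omega⟩
  have : NeZero b := ⟨by omega⟩
  have hg : a.gcd b % 2 = 1 := Nat.odd_iff.1 ((Nat.odd_iff.2 ha).of_dvd_nat (Nat.gcd_dvd_left a b))
  have : NeZero (a.gcd b) := ⟨by omega⟩
  let s : ZMod (a.gcd b) × ZMod (a.gcd b) → ZMod a × ZMod b := fun q =>
    ((q.1.valMinAbs : ZMod a), (q.2.valMinAbs : ZMod b))
  have hs : ∀ q, reduction a b (s q) = q := fun q => by
    simp [s, reduction_intCast]
  have hval : ∀ x : ZMod (a.gcd b), (-x).valMinAbs = -x.valMinAbs := fun x =>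
    ZMod.valMinAbs_neg_of_ne_half (by omega)
  have hsneg : ∀ q, s (-q) = -s q := fun q => by
    simp [s, hval]
  have hw : ∀ q, q + hexRotation (a.gcd b) q + hexRotation _ (hexRotation _ q) = 0 := fun q => by
    ext <;> simp [hexRotation_apply] <;> ring
  have hH := eq_zero_of_add_self_prod ha hb
  obtain ⟨Y, T, hYT, hcard⟩ :=
    exists_isConfig_of_rotation hH (reduction a b) s hs hsneg (hexRotation _) hw
  let K : AddSubgroup (ZMod a × ZMod b) :=
    ((hexRotation _).comp (reduction a b) - reduction a b).ker
  have hK : ∀ h, h ∈ K ↔ hexRotation _ (reduction a b h) = reduction a b h := fun h => by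
    simp [K, AddMonoidHom.mem_ker, sub_eq_zero]
  have hKle : K ≤ AddSubgroup.zmultiples (1, -1) := fun h hh =>
    mem_zmultiples_of_rotation_eq ((hK h).1 hh)
  have hKcyc : IsAddCyclic K := AddSubgroup.isAddCyclic_of_le hKle
  have hKcard : Nat.card K + #{h | hexRotation _ (reduction a b h) ≠ reduction a b h} = a * b := by
    rw [Nat.card_eq_fintype_card, Fintype.card_subtype]
    simp only [hK]
    rw [card_filter_add_card_filter_not]
    simp
  have hKodd : Nat.card K % 2 = 1 := by
    refine Nat.odd_iff.1 (Odd.of_dvd_nat ?_ K.card_addSubgroup_dvd_card)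
    simpa using (Nat.odd_iff.2 ha).mul (Nat.odd_iff.2 hb)
  obtain ⟨Y₀, T₀, h₀, hcard₀⟩ := exists_isConfig_zmod hKodd
  obtain ⟨Y₁, T₁, h₁, hY₁, hT₁⟩ := h₀.map
    (K.subtype.comp (zmodAddCyclicAddEquiv hKcyc).toAddMonoidHom)
    (Subtype.val_injective.comp (zmodAddCyclicAddEquiv hKcyc).injective)
  obtain ⟨h₂, hY₂, hT₂⟩ := h₁.union hYT (by
    rintro _ ⟨z, rfl⟩ y hy hxy
    have hz : ((K.subtype.comp (zmodAddCyclicAddEquiv hKcyc).toAddMonoidHom) z) ∈ K :=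
      SetLike.coe_mem _
    refine hy ((hK y).1 ?_)
    rcases hxy with hxy | hxy
    · rwa [← hxy]
    · rwa [hxy, neg_mem_iff] at hz)
  refine ⟨_, _, h₂, ?_⟩
  rw [hY₂, hT₂]
  omega

/-- For odd `a, b`, splitting off the `2`-part of `Z_{2a} × Z_{2b}`. -/
noncomputable def splitEquiv (ha : a % 2 = 1) (hb : b % 2 = 1) :
    ZMod (2 * a) × ZMod (2 * b) ≃+ (ZMod 2 × ZMod 2) × (ZMod a × ZMod b) :=
  ((ZMod.chineseRemainder (Nat.coprime_two_left.2 (Nat.odd_iff.2 ha))).toAddEquiv.prodCongr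
    (ZMod.chineseRemainder (Nat.coprime_two_left.2 (Nat.odd_iff.2 hb))).toAddEquiv).trans
    (AddEquiv.prodProdProdComm _ _ _ _)

end Product

theorem stmt0 (m n : ℕ) (hm : 0 < m) (hn : 0 < n)
    (hm4 : m % 4 = 2) (hn4 : n % 4 = 2) :
    IsGreatest {b : ℕ | ∃ F : Finset (Finset (ZMod m × ZMod n)),
      OOSPC m n 3 2 1 F ∧ F.card = b} ((5 * m * n + 4) / 24) := by
  obtain ⟨a, rfl⟩ : ∃ a, m = 2 * a := ⟨m / 2, by omega⟩
  obtain ⟨b, rfl⟩ : ∃ b, n = 2 * b := ⟨n / 2, by omega⟩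
  have ha : a % 2 = 1 := by omega
  have hb : b % 2 = 1 := by omega
  have : NeZero a := ⟨by omega⟩
  have : NeZero b := ⟨by omega⟩
  have hH := eq_zero_of_add_self_prod ha hb
  have hbound : (5 * (2 * a) * (2 * b) + 4) / 24 = (5 * (a * b) + 1) / 6 := by
    rw [show 5 * (2 * a) * (2 * b) + 4 = 4 * (5 * (a * b) + 1) by ring,
      show 24 = 4 * 6 from rfl, Nat.mul_div_mul_left _ _ (by norm_num)]
  rw [hbound]
  constructor
  · obtain ⟨Y, T, hYT, hcard⟩ := exists_isConfig_prod ha hb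
    obtain ⟨F, hF, hFcard⟩ := hYT.exists_isCode hH
    obtain ⟨F', hF', hF'card⟩ := hF.map (splitEquiv ha hb).symm
    exact ⟨F', hF', by rw [hF'card, hFcard, hcard]⟩
  · rintro _ ⟨F, hF, rfl⟩
    obtain ⟨F', hF', hF'card⟩ := IsCode.map (splitEquiv ha hb) hF
    have := hF'.card_le hH
    rw [Fintype.card_prod, ZMod.card, ZMod.card] at this
    omega
end

section
/- For all positive integers m and n with m ≡ 2 (mod 4) and n ≡ 2 (mod 4), Θ(m,n,3,3,1) = ⌊(5mn+4+8ξ)/24⌋; that is, there exists an (m,n,3,3,1)-OOSPC with ⌊(5mn+4+8ξ)/24⌋ codewords, and every (m,n,3,3,1)-OOSPC has at most ⌊(5mn+4+8ξ)/24⌋ codewords. -/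
open Finset

/-- The pairs `(a d, a d + d)`, `1 ≤ d ≤ t`, are pairwise disjoint pairs of positive integers. -/
def IsDifferencePairing (t : ℕ) (a : ℕ → ℕ) : Prop :=
  ∀ d ∈ Icc 1 t, 0 < a d ∧ ∀ e ∈ Icc 1 t,
    (a d = a e → d = e) ∧ a d ≠ a e + e ∧ (a d + d = a e + e → d = e)

/-- A Skolem sequence of order `t`, given by the smaller position of each difference. -/
def IsSkolem (t : ℕ) (a : ℕ → ℕ) : Prop :=
  IsDifferencePairing t a ∧ ∀ d ∈ Icc 1 t, a d + d ≤ 2 * t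

/-- A hooked Skolem sequence of order `t`: position `2 * t` is empty. -/
def IsHookedSkolem (t : ℕ) (a : ℕ → ℕ) : Prop :=
  IsDifferencePairing t a ∧
    ∀ d ∈ Icc 1 t, a d + d ≤ 2 * t + 1 ∧ a d ≠ 2 * t ∧ a d + d ≠ 2 * t

/-- A split Skolem (Rosa) sequence of order `t`: position `t + 1` is empty. -/
def IsSplitSkolem (t : ℕ) (a : ℕ → ℕ) : Prop :=
  IsDifferencePairing t a ∧
    ∀ d ∈ Icc 1 t, a d ≠ t + 1 ∧ a d + d ≠ t + 1 ∧ a d + d ≤ 2 * t + 1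

/-- A hooked split Skolem sequence of order `t`: positions `t + 1` and `2 * t + 1` are empty. -/
def IsHookedSplitSkolem (t : ℕ) (a : ℕ → ℕ) : Prop :=
  IsDifferencePairing t a ∧
    ∀ d ∈ Icc 1 t, a d ≠ t + 1 ∧ a d + d ≠ t + 1 ∧ a d + d ≤ 2 * t + 2 ∧
      a d ≠ 2 * t + 1 ∧ a d + d ≠ 2 * t + 1

set_option maxHeartbeats 1000000 in
theorem exists_isSkolem_four_mul (k : ℕ) : ∃ a, IsSkolem (4 * k + 8) a := by
  refine ⟨fun d =>
    if d % 2 = 1 then (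
      if 4 * k + 7 ≤ d then 2 * k + 5
      else if 2 * k + 7 ≤ d then 1 + (4 * k + 5 - d) / 2
      else if 2 * k + 5 ≤ d then k + 1
      else if 2 * k + 3 ≤ d then 2 * k + 4
      else if 3 ≤ d then k + 4 + (2 * k + 1 - d) / 2
      else k + 2)
    else (
      4 * k + 8 + (4 * k + 8 - d) / 2), ?_, ?_⟩
  · intro d hd
    rw [mem_Icc] at hd
    refine ⟨?_, ?_⟩
    · dsimp only
      split_ifs <;> omega
    · intro e he
      rw [mem_Icc] at he
      dsimp only
      split_ifs <;> omega
  · intro d hd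
    rw [mem_Icc] at hd
    dsimp only
    split_ifs <;> omega

set_option maxHeartbeats 1000000 in
theorem exists_isSkolem_four_mul_add_one (k : ℕ) : ∃ a, IsSkolem (4 * k + 9) a := by
  refine ⟨fun d =>
    if d % 2 = 1 then (
      if 4 * k + 9 ≤ d then 2 * k + 5
      else if 2 * k + 5 ≤ d then 1 + (4 * k + 7 - d) / 2
      else if 2 * k + 3 ≤ d then 2 * k + 6
      else if 3 ≤ d then k + 5 + (2 * k + 1 - d) / 2
      else k + 3)
    else (
      4 * k + 10 + (4 * k + 8 - d) / 2), ?_, ?_⟩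
  · intro d hd
    rw [mem_Icc] at hd
    refine ⟨?_, ?_⟩
    · dsimp only
      split_ifs <;> omega
    · intro e he
      rw [mem_Icc] at he
      dsimp only
      split_ifs <;> omega
  · intro d hd
    rw [mem_Icc] at hd
    dsimp only
    split_ifs <;> omega

set_option maxHeartbeats 1000000 in
theorem exists_isHookedSkolem_four_mul_add_two (k : ℕ) : ∃ a, IsHookedSkolem (4 * k + 10) a := by
  refine ⟨fun d =>
    if d % 2 = 1 then (
      if 4 * k + 9 ≤ d then 2 * k + 5
      else if 2 * k + 7 ≤ d then 4 * k + 12 + (4 * k + 7 - d) / 2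
      else if 2 * k + 5 ≤ d then 4 * k + 10
      else if 3 ≤ d then 5 * k + 13 + (2 * k + 3 - d) / 2
      else 7 * k + 17)
    else (
      if 4 * k + 10 ≤ d then 4 * k + 11
      else 1 + (4 * k + 8 - d) / 2), ?_, ?_⟩
  · intro d hd
    rw [mem_Icc] at hd
    refine ⟨?_, ?_⟩
    · dsimp only
      split_ifs <;> omega
    · intro e he
      rw [mem_Icc] at he
      dsimp only
      split_ifs <;> omega
  · intro d hd
    rw [mem_Icc] at hd
    dsimp only
    split_ifs <;> omega

set_option maxHeartbeats 1000000 in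
theorem exists_isHookedSkolem_four_mul_add_three (k : ℕ) : ∃ a, IsHookedSkolem (4 * k + 7) a := by
  refine ⟨fun d =>
    if d % 2 = 1 then (
      if 4 * k + 7 ≤ d then 4 * k + 8
      else if 2 * k + 7 ≤ d then 1 + (4 * k + 5 - d) / 2
      else if 2 * k + 5 ≤ d then k + 1
      else if 2 * k + 3 ≤ d then 2 * k + 4
      else if 3 ≤ d then k + 4 + (2 * k + 1 - d) / 2
      else k + 2)
    else (
      if 4 * k + 6 ≤ d then 2 * k + 5
      else 4 * k + 9 + (4 * k + 4 - d) / 2), ?_, ?_⟩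
  · intro d hd
    rw [mem_Icc] at hd
    refine ⟨?_, ?_⟩
    · dsimp only
      split_ifs <;> omega
    · intro e he
      rw [mem_Icc] at he
      dsimp only
      split_ifs <;> omega
  · intro d hd
    rw [mem_Icc] at hd
    dsimp only
    split_ifs <;> omega

set_option maxHeartbeats 1000000 in
theorem exists_isSplitSkolem_four_mul (k : ℕ) : ∃ a, IsSplitSkolem (4 * k + 8) a := by
  refine ⟨fun d =>
    if d % 2 = 1 then (
      if 3 ≤ d then 1 + (4 * k + 7 - d) / 2
      else 7 * k + 16)
    else (
      if 4 * k + 8 ≤ d then 2 * k + 5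
      else if 2 * k + 8 ≤ d then 4 * k + 11 + (4 * k + 6 - d) / 2
      else if 2 * k + 6 ≤ d then 2 * k + 4
      else 5 * k + 11 + (2 * k + 4 - d) / 2), ?_, ?_⟩
  · intro d hd
    rw [mem_Icc] at hd
    refine ⟨?_, ?_⟩
    · dsimp only
      split_ifs <;> omega
    · intro e he
      rw [mem_Icc] at he
      dsimp only
      split_ifs <;> omega
  · intro d hd
    rw [mem_Icc] at hd
    dsimp only
    split_ifs <;> omega

set_option maxHeartbeats 1000000 in
theorem exists_isSplitSkolem_four_mul_add_three (k : ℕ) : ∃ a, IsSplitSkolem (4 * k + 7) a := by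
  refine ⟨fun d =>
    if d % 2 = 1 then (
      if 4 * k + 7 ≤ d then 2 * k + 4
      else if 2 * k + 7 ≤ d then 4 * k + 9 + (4 * k + 5 - d) / 2
      else if 2 * k + 5 ≤ d then 6 * k + 10
      else if 3 ≤ d then 5 * k + 9 + (2 * k + 3 - d) / 2
      else 7 * k + 13)
    else (
      1 + (4 * k + 6 - d) / 2), ?_, ?_⟩
  · intro d hd
    rw [mem_Icc] at hd
    refine ⟨?_, ?_⟩
    · dsimp only
      split_ifs <;> omega
    · intro e he
      rw [mem_Icc] at he
      dsimp only
      split_ifs <;> omega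
  · intro d hd
    rw [mem_Icc] at hd
    dsimp only
    split_ifs <;> omega

set_option maxHeartbeats 1000000 in
theorem exists_isHookedSplitSkolem_four_mul_add_one (k : ℕ) : ∃ a, IsHookedSplitSkolem (4 * k + 9) a := by
  refine ⟨fun d =>
    if d % 2 = 1 then (
      if 4 * k + 9 ≤ d then 2 * k + 5
      else if 2 * k + 9 ≤ d then 4 * k + 11 + (4 * k + 7 - d) / 2
      else if 2 * k + 7 ≤ d then 6 * k + 13
      else if 3 ≤ d then 5 * k + 11 + (2 * k + 5 - d) / 2
      else 7 * k + 17)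
    else (
      1 + (4 * k + 8 - d) / 2), ?_, ?_⟩
  · intro d hd
    rw [mem_Icc] at hd
    refine ⟨?_, ?_⟩
    · dsimp only
      split_ifs <;> omega
    · intro e he
      rw [mem_Icc] at he
      dsimp only
      split_ifs <;> omega
  · intro d hd
    rw [mem_Icc] at hd
    dsimp only
    split_ifs <;> omega

set_option maxHeartbeats 1000000 in
theorem exists_isHookedSplitSkolem_four_mul_add_two (k : ℕ) : ∃ a, IsHookedSplitSkolem (4 * k + 10) a := by
  refine ⟨fun d =>
    if d % 2 = 1 then (
      if 4 * k + 9 ≤ d then 2 * k + 5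
      else if 2 * k + 9 ≤ d then 4 * k + 12 + (4 * k + 7 - d) / 2
      else if 2 * k + 7 ≤ d then 6 * k + 15
      else if 3 ≤ d then 5 * k + 12 + (2 * k + 5 - d) / 2
      else 7 * k + 18)
    else (
      if 4 * k + 10 ≤ d then 4 * k + 10
      else 1 + (4 * k + 8 - d) / 2), ?_, ?_⟩
  · intro d hd
    rw [mem_Icc] at hd
    refine ⟨?_, ?_⟩
    · dsimp only
      split_ifs <;> omega
    · intro e he
      rw [mem_Icc] at he
      dsimp only
      split_ifs <;> omega
  · intro d hd
    rw [mem_Icc] at hd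
    dsimp only
    split_ifs <;> omega

theorem exists_isSkolem_or_isHookedSkolem (t : ℕ) :
    (∃ a, IsSkolem t a) ∨ ∃ a, IsHookedSkolem t a := by
  by_cases hs : t ≤ 6
  · unfold IsSkolem IsHookedSkolem IsDifferencePairing
    interval_cases t
    · exact Or.inl ⟨fun d => [0].getD d 0, by decide, by decide⟩
    · exact Or.inl ⟨fun d => [0, 1].getD d 0, by decide, by decide⟩
    · exact Or.inr ⟨fun d => [0, 1, 3].getD d 0, by decide, by decide⟩
    · exact Or.inr ⟨fun d => [0, 2, 5, 1].getD d 0, by decide, by decide⟩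
    · exact Or.inl ⟨fun d => [0, 7, 2, 3, 1].getD d 0, by decide, by decide⟩
    · exact Or.inl ⟨fun d => [0, 9, 2, 5, 3, 1].getD d 0, by decide, by decide⟩
    · exact Or.inr ⟨fun d => [0, 4, 9, 10, 2, 3, 1].getD d 0, by decide, by decide⟩
  · have hm : t % 4 < 4 := Nat.mod_lt _ (by norm_num)
    interval_cases hr : t % 4
    · obtain ⟨k, rfl⟩ : ∃ k, t = 4 * k + 8 := ⟨(t - 8) / 4, by omega⟩
      exact Or.inl (exists_isSkolem_four_mul k)
    · obtain ⟨k, rfl⟩ : ∃ k, t = 4 * k + 9 := ⟨(t - 9) / 4, by omega⟩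
      exact Or.inl (exists_isSkolem_four_mul_add_one k)
    · obtain ⟨k, rfl⟩ : ∃ k, t = 4 * k + 10 := ⟨(t - 10) / 4, by omega⟩
      exact Or.inr (exists_isHookedSkolem_four_mul_add_two k)
    · obtain ⟨k, rfl⟩ : ∃ k, t = 4 * k + 7 := ⟨(t - 7) / 4, by omega⟩
      exact Or.inr (exists_isHookedSkolem_four_mul_add_three k)

theorem exists_isSplitSkolem_or_isHookedSplitSkolem (t : ℕ) (ht : t ≠ 1) :
    (∃ a, IsSplitSkolem t a) ∨ ∃ a, IsHookedSplitSkolem t a := by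
  by_cases hs : t ≤ 6
  · unfold IsSplitSkolem IsHookedSplitSkolem IsDifferencePairing
    interval_cases t
    · exact Or.inl ⟨fun d => [0].getD d 0, by decide, by decide⟩
    · exact absurd rfl ht
    · exact Or.inr ⟨fun d => [0, 1, 4].getD d 0, by decide, by decide⟩
    · exact Or.inl ⟨fun d => [0, 6, 1, 2].getD d 0, by decide, by decide⟩
    · exact Or.inl ⟨fun d => [0, 8, 1, 4, 2].getD d 0, by decide, by decide⟩
    · exact Or.inr ⟨fun d => [0, 3, 8, 9, 1, 2].getD d 0, by decide, by decide⟩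
    · exact Or.inr ⟨fun d => [0, 3, 10, 11, 5, 1, 2].getD d 0, by decide, by decide⟩
  · have hm : t % 4 < 4 := Nat.mod_lt _ (by norm_num)
    interval_cases hr : t % 4
    · obtain ⟨k, rfl⟩ : ∃ k, t = 4 * k + 8 := ⟨(t - 8) / 4, by omega⟩
      exact Or.inl (exists_isSplitSkolem_four_mul k)
    · obtain ⟨k, rfl⟩ : ∃ k, t = 4 * k + 9 := ⟨(t - 9) / 4, by omega⟩
      exact Or.inr (exists_isHookedSplitSkolem_four_mul_add_one k)
    · obtain ⟨k, rfl⟩ : ∃ k, t = 4 * k + 10 := ⟨(t - 10) / 4, by omega⟩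
      exact Or.inr (exists_isHookedSplitSkolem_four_mul_add_two k)
    · obtain ⟨k, rfl⟩ : ∃ k, t = 4 * k + 7 := ⟨(t - 7) / 4, by omega⟩
      exact Or.inl (exists_isSplitSkolem_four_mul_add_three k)

theorem eq_zero_of_add_self_eq_zero {H : Type*} [AddCommGroup H] (hodd : Odd (Nat.card H))
    {x : H} (hx : x + x = 0) : x = 0 := by
  have h2 : addOrderOf x ∣ 2 := addOrderOf_dvd_of_nsmul_eq_zero (by rw [two_nsmul, hx])
  have h1 : addOrderOf x ∣ Nat.card H := addOrderOf_dvd_natCard x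
  have hc : Nat.Coprime (Nat.card H) 2 := Nat.coprime_two_right.mpr hodd
  have : addOrderOf x ∣ 1 := by
    rw [← hc.gcd_eq_one]
    exact Nat.dvd_gcd h1 h2
  exact AddMonoid.addOrderOf_eq_one_iff.mp (Nat.dvd_one.mp this)

/-- A finite set contains a subset which is separated with respect to a symmetric relation
and large with respect to the sizes of the neighbourhoods. -/
theorem exists_separated_subset {α : Type*} [DecidableEq α] (N : α → Finset α) (k : ℕ)
    (hcard : ∀ x, (N x).card ≤ k) (hself : ∀ x, x ∈ N x) (hsymm : ∀ x y, y ∈ N x → x ∈ N y)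
    (S : Finset α) :
    ∃ T ⊆ S, (∀ x ∈ T, ∀ y ∈ T, y ∈ N x → x = y) ∧ S.card ≤ k * T.card := by
  induction S using Finset.strongInduction with
  | H S ih =>
    rcases S.eq_empty_or_nonempty with rfl | ⟨x, hx⟩
    · exact ⟨∅, by simp, by simp, by simp⟩
    · have hss : S \ N x ⊂ S :=
        (Finset.ssubset_iff_of_subset sdiff_subset).mpr ⟨x, hx, by simp [hself]⟩
      obtain ⟨T, hTS, hT, hc⟩ := ih _ hss
      have hxT : x ∉ T := fun h => by simpa [hself] using hTS h
      refine ⟨insert x T, ?_, ?_, ?_⟩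
      · exact insert_subset hx (hTS.trans sdiff_subset)
      · intro y hy z hz hzy
        rcases mem_insert.mp hy with hy1 | hy1 <;> rcases mem_insert.mp hz with hz1 | hz1
        · rw [hy1, hz1]
        · exact absurd (hy1 ▸ hzy) (mem_sdiff.mp (hTS hz1)).2
        · exact absurd (hsymm _ _ (hz1 ▸ hzy)) (mem_sdiff.mp (hTS hy1)).2
        · exact hT y hy1 z hz1 hzy
      · rw [card_insert_of_notMem hxT]
        have := card_le_card_sdiff_add_card (s := S) (t := N x)
        have := hcard x
        rw [mul_add]
        omega

/-- Zero-sum triples of elements of order different from `1` and `3`, any two of which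
(and any two members of which) are disjoint up to sign. -/
def IsTripleFamily {ι H : Type} [AddCommGroup H] (f : ι → Fin 3 → H) : Prop :=
  (∀ i, f i 0 + f i 1 + f i 2 = 0) ∧ (∀ i j, 3 • f i j ≠ 0) ∧
    ∀ i j i' j', (f i j = f i' j' ∨ f i j = -f i' j') → i = i' ∧ j = j'

/-- The number of solutions of `3 • x = 0`. -/
noncomputable def threeTorsionCard (H : Type) [AddCommGroup H] : ℕ :=
  Nat.card {x : H // 3 • x = 0}

/-- The elements `x` of `H` with `3 • x ≠ 0` can be partitioned, up to sign, into zero-sum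
triples, with at most four elements left over. -/
def HasLargeTripleFamily (H : Type) [AddCommGroup H] : Prop :=
  ∃ (ι : Type) (_ : Finite ι) (f : ι → Fin 3 → H), IsTripleFamily f ∧
    Nat.card H ≤ 6 * Nat.card ι + threeTorsionCard H + 4

theorem threeTorsionCard_congr {H H' : Type} [AddCommGroup H] [AddCommGroup H'] (e : H ≃+ H') :
    threeTorsionCard H = threeTorsionCard H' := by
  refine Nat.card_congr (e.toEquiv.subtypeEquiv fun x => ?_)
  change _ ↔ 3 • e x = 0
  rw [← map_nsmul, EmbeddingLike.map_eq_zero_iff]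

theorem threeTorsionCard_le_of_injective {H K : Type} [AddCommGroup H] [AddCommGroup K] [Finite H]
    (φ : K →+ H) (hφ : Function.Injective φ) : threeTorsionCard K ≤ threeTorsionCard H := by
  refine Nat.card_le_card_of_injective
    (fun x : {x : K // 3 • x = 0} =>
      (⟨φ x, by rw [← map_nsmul, x.2, map_zero]⟩ : {x : H // 3 • x = 0})) ?_
  intro x y hxy
  exact Subtype.ext (hφ (Subtype.ext_iff.mp hxy))

theorem threeTorsionCard_zmod (n : ℕ) [NeZero n] : threeTorsionCard (ZMod n) = n.gcd 3 := by
  have := IsAddCyclic.card_nsmulAddMonoidHom_ker (G := ZMod n) 3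
  rwa [Nat.card_zmod] at this

theorem threeTorsionCard_prod (H K : Type) [AddCommGroup H] [AddCommGroup K] :
    threeTorsionCard (H × K) = threeTorsionCard H * threeTorsionCard K := by
  unfold threeTorsionCard
  rw [← Nat.card_prod]
  refine Nat.card_congr ⟨fun x => (⟨x.1.1, congrArg Prod.fst x.2⟩, ⟨x.1.2, congrArg Prod.snd x.2⟩),
    fun x => ⟨(x.1.1, x.2.1), Prod.ext x.1.2 x.2.2⟩, fun _ => rfl, fun _ => rfl⟩

theorem HasLargeTripleFamily.congr {H H' : Type} [AddCommGroup H] [AddCommGroup H'] (e : H ≃+ H')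
    (h : HasLargeTripleFamily H) : HasLargeTripleFamily H' := by
  obtain ⟨ι, hι, f, ⟨h0, h3, hd⟩, hc⟩ := h
  refine ⟨ι, hι, fun i j => e (f i j), ⟨fun i => ?_, fun i j => ?_, fun i j i' j' h => ?_⟩, ?_⟩
  · rw [← map_add, ← map_add, h0, map_zero]
  · rw [← map_nsmul]
    exact fun h => h3 i j (e.map_eq_zero_iff.mp h)
  · refine hd i j i' j' ?_
    simpa [← map_neg] using h
  · rwa [← Nat.card_congr e.toEquiv, ← threeTorsionCard_congr e]

/-- Triples in a quotient `Q` lift to `H`; what remains is a subgroup `K`, the preimage of the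
`3`-torsion of `Q`. -/
theorem HasLargeTripleFamily.extension {H K Q : Type} [AddCommGroup H] [AddCommGroup K]
    [AddCommGroup Q] [Finite H] [Finite K] [Finite Q] (hH : Odd (Nat.card H))
    (hQ : Odd (Nat.card Q)) (π : H →+ Q) (hπ : Function.Surjective π) (φ : K →+ H)
    (hφ : Function.Injective φ) (hφπ : ∀ k, 3 • π (φ k) = 0)
    (hcard : Nat.card K * Nat.card Q = threeTorsionCard Q * Nat.card H)
    (hmod : Nat.card Q % 6 = threeTorsionCard Q % 6)
    (hfQ : HasLargeTripleFamily Q) (hfK : HasLargeTripleFamily K) : HasLargeTripleFamily H := by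
  obtain ⟨ι, hι, f, ⟨hf0, hf3, hfd⟩, hfc⟩ := hfQ
  obtain ⟨κ, hκ, g, ⟨hg0, hg3, hgd⟩, hgc⟩ := hfK
  set s := Function.surjInv hπ with hs
  have hπs : ∀ q, π (s q) = q := Function.surjInv_eq hπ
  let F : ι × π.ker ⊕ κ → Fin 3 → H := Sum.elim
    (fun p => ![s (f p.1 0) + p.2, s (f p.1 1) + p.2,
      -(s (f p.1 0) + s (f p.1 1)) - ((p.2 : H) + p.2)])
    (fun c j => φ (g c j))
  have hFπ : ∀ p j, π (F (Sum.inl p) j) = f p.1 j := by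
    rintro ⟨i, k⟩ j
    have hk : π (k : H) = 0 := k.2
    fin_cases j
    · simp [F, hπs, hk]
    · simp [F, hπs, hk]
    · simp only [F, Sum.elim_inl, Fin.reduceFinMk, Matrix.cons_val, map_sub, map_neg, map_add, hπs,
        hk, add_zero, sub_zero]
      exact neg_eq_of_add_eq_zero_right (hf0 i)
  have hFK : ∀ c j, F (Sum.inr c) j = φ (g c j) := fun _ _ => rfl
  refine ⟨ι × π.ker ⊕ κ, inferInstance, F, ⟨?_, ?_, ?_⟩, ?_⟩
  · rintro (⟨i, k⟩ | c)
    · simp only [F, Sum.elim_inl, Matrix.cons_val]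
      abel
    · simp only [hFK, ← map_add, hg0, map_zero]
  · rintro (p | c) j h
    · refine hf3 p.1 j ?_
      rw [← hFπ, ← map_nsmul, h, map_zero]
    · rw [hFK, ← map_nsmul, map_eq_zero_iff φ hφ] at h
      exact hg3 c j h
  · have key : ∀ p c j j', ¬ (F (Sum.inl p) j = F (Sum.inr c) j' ∨
        F (Sum.inl p) j = -F (Sum.inr c) j') := by
      intro p c j j' h
      refine hf3 p.1 j ?_
      rw [← hFπ]
      rcases h with h | h <;> simp [h, hFK, hφπ]
    rintro (⟨i, k⟩ | c) j (⟨i', k'⟩ | c') j' h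
    · have h' : f i j = f i' j' ∨ f i j = -f i' j' := by
        rcases h with h | h
        · left
          rw [← hFπ (i, k), ← hFπ (i', k'), h]
        · right
          rw [← hFπ (i, k), ← hFπ (i', k'), h, map_neg]
      obtain ⟨rfl, rfl⟩ := hfd _ _ _ _ h'
      refine ⟨?_, rfl⟩
      have hne : F (Sum.inl (i, k)) j ≠ -F (Sum.inl (i, k')) j := by
        intro h
        have h2 : f i j = -f i j := by
          conv_lhs => rw [← hFπ (i, k), h, map_neg, hFπ]
        refine hf3 i j ?_
        rw [eq_zero_of_add_self_eq_zero hQ (eq_neg_iff_add_eq_zero.mp h2), smul_zero]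
      have h := h.resolve_right hne
      have hk : (k : H) = k' := by
        fin_cases j
        · simpa [F] using h
        · simpa [F] using h
        · simp only [F, Sum.elim_inl, Fin.reduceFinMk, Matrix.cons_val, sub_right_inj] at h
          refine sub_eq_zero.mp (eq_zero_of_add_self_eq_zero hH ?_)
          rw [sub_add_sub_comm, h, sub_self]
      rw [Subtype.ext hk]
    · exact absurd h (key _ _ _ _)
    · refine absurd ?_ (key (i', k') c j' j)
      rcases h with h | h
      · exact Or.inl h.symm
      · exact Or.inr (neg_eq_iff_eq_neg.mp h.symm)
    · have := hgd c j c' j' (by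
        rcases h with h | h
        · exact Or.inl (hφ h)
        · refine Or.inr (hφ ?_)
          rw [map_neg]
          exact h)
      exact ⟨by rw [this.1], this.2⟩
  · have hker : Nat.card π.ker * Nat.card Q = Nat.card H := by
      rw [← AddSubgroup.card_mul_index π.ker, AddSubgroup.index_ker,
        AddMonoidHom.range_eq_top.mpr hπ, AddSubgroup.card_top]
    have hT := threeTorsionCard_le_of_injective φ hφ
    have hQpos : 0 < Nat.card Q := Nat.card_pos
    have hQle : threeTorsionCard Q ≤ Nat.card Q := Nat.card_le_card_of_injective _ Subtype.val_injective
    have hQ6 : Nat.card Q ≤ 6 * Nat.card ι + threeTorsionCard Q := by omega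
    have hK : Nat.card K = threeTorsionCard Q * Nat.card π.ker := by
      refine Nat.eq_of_mul_eq_mul_right hQpos ?_
      rw [hcard, ← hker, mul_assoc]
    rw [Nat.card_sum, Nat.card_prod]
    have := Nat.mul_le_mul_left (Nat.card π.ker) hQ6
    nlinarith

/-- An endomorphism `σ` with `1 + σ + σ² = 0` provides the triples `{x, σ x, σ² x}`. -/
theorem hasLargeTripleFamily_of_cubic {H : Type} [AddCommGroup H] [Finite H]
    (σ : H →+ H) (hσ : ∀ x, x + σ x + σ (σ x) = 0) : HasLargeTripleFamily H := by
  classical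
  have := Fintype.ofFinite H
  have h3 : ∀ x, σ (σ (σ x)) = x := by
    intro x
    have h1 := hσ x
    have h2 := hσ (σ x)
    have : σ (σ (σ x)) - x = (σ x + σ (σ x) + σ (σ (σ x))) - (x + σ x + σ (σ x)) := by abel
    rw [h1, h2, sub_zero] at this
    exact sub_eq_zero.mp this
  have hfix : ∀ x, 3 • x ≠ 0 → x ≠ σ x := by
    intro x hx h
    refine hx ?_
    have := hσ x
    rw [← h, ← h] at this
    rw [← this]
    abel
  have hneg : ∀ x, 3 • x ≠ 0 → x ≠ -σ x := by
    intro x hx h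
    refine hx ?_
    have h1 := hσ x
    rw [eq_neg_iff_add_eq_zero.mp h, zero_add] at h1
    rw [← h3 x, h1, map_zero, smul_zero]
  let N : H → Finset H := fun x => {x, σ x, σ (σ x), -x, -σ x, -σ (σ x)}
  have hN : ∀ x y, y ∈ N x ↔ y = x ∨ y = σ x ∨ y = σ (σ x) ∨ y = -x ∨ y = -σ x ∨ y = -σ (σ x) := by
    intro x y
    simp [N]
  obtain ⟨T, hTS, hT, hc⟩ := exists_separated_subset N 6 (fun x => card_le_six) (fun x => by simp [N])
    (fun x y h => by
      rw [hN] at h ⊢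
      rcases h with rfl | rfl | rfl | rfl | rfl | rfl <;> simp [h3])
    {x : H | 3 • x ≠ 0}
  have hT3 : ∀ x ∈ T, 3 • x ≠ 0 := fun x hx => by simpa using hTS hx
  have hinj : Function.Injective σ := fun x y h => by rw [← h3 x, h, h3]
  refine ⟨T, inferInstance, fun x => ![x, σ x, σ (σ x)], ⟨fun x => hσ x, ?_, ?_⟩, ?_⟩
  · rintro ⟨x, hx⟩ j h
    have := hT3 x hx
    fin_cases j
    · exact this h
    · simp only [Fin.reduceFinMk, Matrix.cons_val, ← map_nsmul] at h
      exact this (by rw [← h3 (3 • x), h, map_zero, map_zero])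
    · simp only [Fin.reduceFinMk, Matrix.cons_val, ← map_nsmul] at h
      exact this (by rw [← h3 (3 • x), h, map_zero])
  · rintro ⟨x, hx⟩ j ⟨y, hy⟩ k h
    have hyw : ∀ w, (w = ![y, σ y, σ (σ y)] k ∨ w = -![y, σ y, σ (σ y)] k) → y ∈ N w := by
      intro w hw
      rw [hN]
      fin_cases k <;> rcases hw with rfl | rfl <;> simp [h3]
    have hxy : y ∈ N x := by
      have h' := hyw _ h
      rw [hN] at h' ⊢
      fin_cases j <;> simp [h3] at h' <;> tauto
    obtain rfl := hT x hx y hy hxy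
    refine ⟨rfl, ?_⟩
    have a1 := hfix x (hT3 x hx)
    have a2 : σ x ≠ σ (σ x) := fun h => a1 (hinj h)
    have a3 : σ (σ x) ≠ x := fun h => a2 (hinj (h.trans (h3 x).symm))
    have b1 := hneg x (hT3 x hx)
    have b2 : σ x ≠ -σ (σ x) := fun h => b1 (hinj (by rw [map_neg, ← h]))
    have b3 : σ (σ x) ≠ -x := fun h => b2 (hinj (by rw [map_neg, h3, ← h]))
    have flip : ∀ {u v : H}, u = -v → v = -u := fun h => neg_eq_iff_eq_neg.mp h.symm
    fin_cases j <;> fin_cases k <;> first | rfl | skip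
    all_goals
      exfalso
      simp only [Fin.reduceFinMk, Fin.zero_eta, Fin.mk_one, Matrix.cons_val] at h
      rcases h with h | h
      · first | exact a1 h | exact a2 h | exact a3 h | exact a1 h.symm | exact a2 h.symm |
          exact a3 h.symm
      · first | exact b1 h | exact b2 h | exact b3 h | exact b1 (flip h) | exact b2 (flip h) |
          exact b3 (flip h)
  · have h1 : Nat.card H = #({x : H | 3 • x ≠ 0} : Finset H) + threeTorsionCard H := by
      rw [threeTorsionCard, Nat.card_eq_fintype_card,
        Nat.card_eq_fintype_card (α := {x : H // 3 • x = 0}), Fintype.card_subtype, ← card_univ,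
        ← card_filter_add_card_filter_not (s := univ) (fun x : H => 3 • x ≠ 0)]
      simp
    rw [Nat.card_eq_fintype_card (α := T), Fintype.card_coe]
    omega

/-- A difference pairing yields a triple family `{d, t + a d, -(t + a d + d)}` in a cyclic group
of odd order. -/
theorem hasLargeTripleFamily_zmod_of_isDifferencePairing {N M t c : ℕ} {a : ℕ → ℕ}
    (ha : IsDifferencePairing t a) (hN : N = 2 * M + 1) (hc : c = M ∨ c = M + 1) (htN : 3 * t < N)
    (htM : t < M ∨ t = 0)
    (hle : ∀ d ∈ Icc 1 t, a d + d + t ≤ M + 1)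
    (hne : ∀ d ∈ Icc 1 t, a d + t ≠ c ∧ a d + d + t ≠ c)
    (hN3 : ∀ d ∈ Icc 1 t, 3 * (a d + t) ≠ N ∧ 3 * (a d + d + t) ≠ N)
    (hcard : N ≤ 6 * t + N.gcd 3 + 4) : HasLargeTripleFamily (ZMod N) := by
  have : NeZero N := ⟨by omega⟩
  let v : Fin t → Fin 3 → ℕ := fun i =>
    ![i + 1, a (i + 1) + t, a (i + 1) + (i + 1) + t]
  let f : Fin t → Fin 3 → ZMod N := fun i =>
    ![(i + 1 : ℕ), (a (i + 1) + t : ℕ), -(a (i + 1) + (i + 1) + t : ℕ)]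
  have hmem : ∀ i : Fin t, (i : ℕ) + 1 ∈ Icc 1 t := fun i => mem_Icc.mpr ⟨by omega, i.2⟩
  have hf : ∀ i j, f i j = v i j ∨ f i j = -(v i j : ZMod N) := by
    intro i j
    fin_cases j <;> simp [f, v]
  have hv : ∀ i j, 0 < v i j ∧ v i j ≤ M + 1 ∧ v i j ≠ c ∧ 3 * v i j ≠ N ∧ 2 ≤ M := by
    intro i j
    have h0 := (ha _ (hmem i)).1
    have h1 := hle _ (hmem i)
    have h2 := hne _ (hmem i)
    have h3 := hN3 _ (hmem i)
    have := i.2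
    fin_cases j <;> simp only [v, Fin.reduceFinMk, Fin.zero_eta, Fin.mk_one, Matrix.cons_val] <;>
      omega
  have hcast : ∀ x y : ℕ, 0 < x → x ≤ M + 1 → x ≠ c → 0 < y → y ≤ M + 1 → y ≠ c →
      ((x : ZMod N) = y ∨ (x : ZMod N) = -y) → x = y := by
    intro x y hx hx' hxc hy hy' hyc h
    rcases h with h | h
    · by_cases hM : M = 0
      · omega
      · rw [ZMod.natCast_eq_natCast_iff, Nat.ModEq, Nat.mod_eq_of_lt (by omega),
          Nat.mod_eq_of_lt (by omega)] at h
        exact h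
    · rw [eq_neg_iff_add_eq_zero, ← Nat.cast_add, ZMod.natCast_eq_zero_iff] at h
      obtain ⟨k, hk⟩ := h
      rcases k with _ | _ | k
      · omega
      · omega
      · nlinarith
  refine ⟨Fin t, inferInstance, f, ⟨fun i => ?_, fun i j h => ?_, fun i j i' j' h => ?_⟩, ?_⟩
  · simp only [f, Matrix.cons_val]
    push_cast
    ring
  · obtain ⟨h0, h1, -, h3, hM⟩ := hv i j
    have h : ((3 * v i j : ℕ) : ZMod N) = 0 := by
      rw [Nat.cast_mul]
      rcases hf i j with h' | h' <;> simpa [h'] using h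
    rw [ZMod.natCast_eq_zero_iff] at h
    obtain ⟨k, hk⟩ := h
    rcases k with _ | _ | k
    · omega
    · omega
    · nlinarith
  · obtain ⟨h0, h1, h2, -⟩ := hv i j
    obtain ⟨h0', h1', h2', -⟩ := hv i' j'
    have hvv : v i j = v i' j' := by
      refine hcast _ _ h0 h1 h2 h0' h1' h2' ?_
      rcases hf i j with e | e <;> rcases hf i' j' with e' | e' <;> rw [e, e'] at h
      · exact h
      · rwa [neg_neg, or_comm] at h
      · rwa [neg_inj, neg_eq_iff_eq_neg, or_comm] at h
      · rwa [neg_neg, neg_inj, neg_eq_iff_eq_neg] at h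
    have p := (ha _ (hmem i)).2 _ (hmem i')
    have q := (ha _ (hmem i)).1
    have p' := (ha _ (hmem i')).2 _ (hmem i)
    have q' := (ha _ (hmem i')).1
    have := i.2
    have := i'.2
    rw [Fin.ext_iff]
    fin_cases j <;> fin_cases j' <;>
      simp only [v, Fin.reduceFinMk, Fin.zero_eta, Fin.mk_one, Matrix.cons_val] at hvv <;>
      simp <;> omega
  · rw [threeTorsionCard_zmod, Nat.card_zmod, Nat.card_eq_fintype_card, Fintype.card_fin]
    exact hcard

theorem hasLargeTripleFamily_zmod {N : ℕ} (hN : Odd N) (h9 : N ≠ 9) :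
    HasLargeTripleFamily (ZMod N) := by
  obtain ⟨M, hM⟩ := hN
  have h3 : N.gcd 3 = if N % 3 = 0 then 3 else 1 := by
    rw [Nat.gcd_comm, Nat.gcd_rec]
    have : N % 3 < 3 := Nat.mod_lt _ (by norm_num)
    interval_cases N % 3 <;> rfl
  have hd : ∀ {t d : ℕ}, d ∈ Icc 1 t → 1 ≤ d ∧ d ≤ t := mem_Icc.mp
  have hcases : ∃ t, N = 6 * t + 1 ∨ N = 6 * t + 3 ∨ N = 6 * t + 5 := ⟨N / 6, by omega⟩
  obtain ⟨t, rfl | rfl | rfl⟩ := hcases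
  · have h3 : (6 * t + 1).gcd 3 = 1 := by rw [h3, if_neg (by omega)]
    rcases exists_isSkolem_or_isHookedSkolem t with ⟨a, ha, ha'⟩ | ⟨a, ha, ha'⟩
    · refine hasLargeTripleFamily_zmod_of_isDifferencePairing (c := M + 1) ha hM (by omega)
        (by omega) (by omega) (fun d h => ?_) (fun d h => ?_) (fun d h => ?_) (by omega) <;>
        have := ha' d h <;> have := hd h <;> omega
    · refine hasLargeTripleFamily_zmod_of_isDifferencePairing (c := M) ha hM (by omega)
        (by omega) (by omega) (fun d h => ?_) (fun d h => ?_) (fun d h => ?_) (by omega) <;>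
        have := ha' d h <;> have := hd h <;> omega
  · have h3 : (6 * t + 3).gcd 3 = 3 := by rw [h3, if_pos (by omega)]
    rcases exists_isSplitSkolem_or_isHookedSplitSkolem t (by omega) with ⟨a, ha, ha'⟩ | ⟨a, ha, ha'⟩
    · refine hasLargeTripleFamily_zmod_of_isDifferencePairing (c := M + 1) ha hM (by omega)
        (by omega) (by omega) (fun d h => ?_) (fun d h => ?_) (fun d h => ?_) (by omega) <;>
        have := ha' d h <;> have := hd h <;> omega
    · refine hasLargeTripleFamily_zmod_of_isDifferencePairing (c := M) ha hM (by omega)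
        (by omega) (by omega) (fun d h => ?_) (fun d h => ?_) (fun d h => ?_) (by omega) <;>
        have := ha' d h <;> have := hd h <;> omega
  · have h3 : (6 * t + 5).gcd 3 = 1 := by rw [h3, if_neg (by omega)]
    rcases exists_isSkolem_or_isHookedSkolem t with ⟨a, ha, ha'⟩ | ⟨a, ha, ha'⟩ <;>
    · refine hasLargeTripleFamily_zmod_of_isDifferencePairing (c := M + 1) ha hM (by omega)
        (by omega) (by omega) (fun d h => ?_) (fun d h => ?_) (fun d h => ?_) (by omega) <;>
        have := ha' d h <;> have := hd h <;> omega

theorem hasLargeTripleFamily_prod_self {H : Type} [AddCommGroup H] [Finite H] :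
    HasLargeTripleFamily (H × H) := by
  refine hasLargeTripleFamily_of_cubic
    (AddMonoidHom.prod (-AddMonoidHom.snd H H) (AddMonoidHom.fst H H - AddMonoidHom.snd H H))
    fun x => Prod.ext ?_ ?_
  · simp
    abel
  · simp
    abel

theorem hasLargeTripleFamily_zmod_three_prod_nine : HasLargeTripleFamily (ZMod 3 × ZMod 9) := by
  refine ⟨Fin 3, inferInstance, ![![(0, 1), (1, 1), (2, 7)], ![(0, 4), (1, 4), (2, 1)],
    ![(0, 7), (1, 7), (2, 4)]], ?_, ?_⟩
  · unfold IsTripleFamily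
    decide +kernel
  · rw [threeTorsionCard_prod, threeTorsionCard_zmod, threeTorsionCard_zmod, Nat.card_prod,
      Nat.card_zmod, Nat.card_zmod, Nat.card_eq_fintype_card, Fintype.card_fin]
    norm_num

theorem HasLargeTripleFamily.lift {r g c b : ℕ} (hr : r = 1 ∨ r = 3) (hg : r * g % 6 = r)
    (hg9 : r * g ≠ 9) (hc : Odd c) (hb : Odd b) (h : HasLargeTripleFamily (ZMod (r * c) × ZMod b)) :
    HasLargeTripleFamily (ZMod (r * g * c) × ZMod b) := by
  have hr1 : Odd r := by rcases hr with rfl | rfl <;> decide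
  have hg1 : Odd (r * g) := Nat.odd_iff.mpr (by omega)
  have : NeZero b := ⟨hb.pos.ne'⟩
  have : NeZero c := ⟨hc.pos.ne'⟩
  have : NeZero r := ⟨hr1.pos.ne'⟩
  have : NeZero (r * g) := ⟨hg1.pos.ne'⟩
  have hg0 : 0 < g := Nat.pos_of_ne_zero (by rintro rfl; simp at hg1)
  have hdvd : ((r * g * c : ℕ) : ℤ) ∣ (r * c : ℕ) * g :=
    ⟨1, by push_cast; ring⟩
  let φ₁ : ZMod (r * c) →+ ZMod (r * g * c) := ZMod.lift (r * c)
    ⟨(zmultiplesHom _ (g : ZMod (r * g * c))), by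
      simp only [zmultiplesHom_apply, zsmul_eq_mul]
      rw [← Int.cast_natCast g, ← Int.cast_mul, ZMod.intCast_zmod_eq_zero_iff_dvd]
      exact hdvd⟩
  have hφ₁ : ∀ k : ℤ, φ₁ k = (k * g : ℤ) := by
    intro k
    rw [ZMod.lift_coe]
    simp
  have hφinj : Function.Injective φ₁ := by
    rw [injective_iff_map_eq_zero]
    intro x hx
    obtain ⟨k, rfl⟩ := ZMod.intCast_surjective x
    rw [hφ₁, ZMod.intCast_zmod_eq_zero_iff_dvd] at hx
    rw [ZMod.intCast_zmod_eq_zero_iff_dvd]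
    have hg' : (g : ℤ) ≠ 0 := by exact_mod_cast hg0.ne'
    refine Int.dvd_of_mul_dvd_mul_right hg' ?_
    convert hx using 1
    push_cast
    ring
  let π : ZMod (r * g * c) →+* ZMod (r * g) := ZMod.castHom ⟨c, rfl⟩ _
  have h3 : threeTorsionCard (ZMod (r * g)) = r := by
    rw [threeTorsionCard_zmod]
    rcases hr with rfl | rfl
    · rw [one_mul] at hg ⊢
      refine Nat.Coprime.symm ((Nat.Prime.coprime_iff_not_dvd Nat.prime_three).mpr ?_)
      omega
    · exact Nat.gcd_mul_right_left _ _
  refine HasLargeTripleFamily.extension (K := ZMod (r * c) × ZMod b) (Q := ZMod (r * g)) ?_ ?_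
    (π.toAddMonoidHom.comp (AddMonoidHom.fst _ _))
    ((ZMod.castHom_surjective (⟨c, rfl⟩ : r * g ∣ r * g * c)).comp Prod.fst_surjective)
    (φ₁.prodMap (AddMonoidHom.id _)) ?_ ?_ ?_ ?_ (hasLargeTripleFamily_zmod hg1 hg9) h
  · rw [Nat.card_prod, Nat.card_zmod, Nat.card_zmod]
    exact (hg1.mul hc).mul hb
  · rwa [Nat.card_zmod]
  · exact hφinj.prodMap Function.injective_id
  · rintro ⟨k, y⟩
    obtain ⟨k, rfl⟩ := ZMod.intCast_surjective k
    change 3 • π (φ₁ k) = 0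
    rw [hφ₁, map_intCast, nsmul_eq_mul]
    have : ((3 * (k * g) : ℤ) : ZMod (r * g)) = 0 := by
      rw [ZMod.intCast_zmod_eq_zero_iff_dvd]
      rcases hr with rfl | rfl
      · exact ⟨3 * k, by push_cast; ring⟩
      · exact ⟨k, by push_cast; ring⟩
    exact_mod_cast this
  · rw [h3, Nat.card_prod, Nat.card_prod]
    simp only [Nat.card_zmod]
    ring
  · rw [h3, Nat.card_zmod, hg]
    rcases hr with rfl | rfl <;> rfl

theorem exists_prime_dvd_mod_six_eq_five (a : ℕ) (ha : a % 6 = 5) :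
    ∃ p, p.Prime ∧ p % 6 = 5 ∧ p ∣ a := by
  induction a using Nat.strong_induction_on with
  | _ a ih =>
    have hp : a.minFac.Prime := Nat.minFac_prime (by omega)
    obtain ⟨b, hb⟩ := Nat.minFac_dvd a
    set p := a.minFac
    have hmod := Nat.mul_mod p b 6
    rw [← hb, ha] at hmod
    have hmul : ∀ x < 6, ∀ y < 6, 5 = x * y % 6 → x = 5 ∨ y = 5 := by decide
    have hcases := hmul _ (Nat.mod_lt p (by norm_num)) _ (Nat.mod_lt b (by norm_num)) hmod
    rcases hcases with h | h
    · exact ⟨p, hp, h, ⟨b, hb⟩⟩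
    · obtain ⟨q, hq, hq5, hqb⟩ := ih b (by nlinarith [hp.two_le, show 0 < b by omega]) h
      exact ⟨q, hq, hq5, hqb.trans ⟨p, by rw [mul_comm, ← hb]⟩⟩

theorem hasLargeTripleFamily_zmod_prod_of_coprime {a b : ℕ} (ha : Odd a) (hb : Odd b)
    (hab : a.Coprime b) (h9 : a * b ≠ 9) : HasLargeTripleFamily (ZMod a × ZMod b) :=
  (hasLargeTripleFamily_zmod (ha.mul hb) h9).congr (ZMod.chineseRemainder hab).toAddEquiv

theorem HasLargeTripleFamily.swap {H K : Type} [AddCommGroup H] [AddCommGroup K]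
    (h : HasLargeTripleFamily (H × K)) : HasLargeTripleFamily (K × H) :=
  h.congr AddEquiv.prodComm

/-- Lifting from the trivial group or the group of order three. -/
theorem HasLargeTripleFamily.lift_of_mod {r a b : ℕ} (hr : r = 1 ∨ r = 3) (ha : a % 6 = r)
    (h9 : a ≠ 9) (hb : Odd b) (h : HasLargeTripleFamily (ZMod r × ZMod b)) :
    HasLargeTripleFamily (ZMod a × ZMod b) := by
  obtain ⟨g, rfl⟩ : r ∣ a := by
    rcases hr with rfl | rfl
    · exact one_dvd _
    · omega
  have := HasLargeTripleFamily.lift (c := 1) hr ha h9 odd_one hb (by rwa [mul_one])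
  rwa [mul_one] at this

theorem hasLargeTripleFamily_zmod_prod {a b : ℕ} (ha : Odd a) (hb : Odd b)
    (h19 : ¬ (a = 1 ∧ b = 9)) (h91 : ¬ (a = 9 ∧ b = 1)) :
    HasLargeTripleFamily (ZMod a × ZMod b) := by
  have ha2 := Nat.odd_iff.mp ha
  have hb2 := Nat.odd_iff.mp hb
  -- the case where three divides the first factor only
  have key : ∀ {a b : ℕ}, Odd a → Odd b → a % 3 = 0 → b % 3 ≠ 0 → ¬ (a = 9 ∧ b = 1) →
      HasLargeTripleFamily (ZMod a × ZMod b) := by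
    intro a b ha hb ha3 hb3 h91
    have h3b : Nat.Coprime 3 b := (Nat.Prime.coprime_iff_not_dvd Nat.prime_three).mpr (by omega)
    by_cases h9 : a = 9
    · subst h9
      exact hasLargeTripleFamily_zmod_prod_of_coprime ha hb (Nat.Coprime.pow_left 2 h3b) (by omega)
    · have := Nat.odd_iff.mp ha
      exact HasLargeTripleFamily.lift_of_mod (Or.inr rfl) (by omega) h9 hb
        (hasLargeTripleFamily_zmod_prod_of_coprime (by decide) hb h3b (by omega))
  by_cases ha3 : a % 3 = 0 <;> by_cases hb3 : b % 3 = 0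
  · -- both factors are divisible by three
    have h39 : ∀ {c d : ℕ}, (c = 3 ∨ c = 9) → (d = 3 ∨ d = 9) →
        HasLargeTripleFamily (ZMod c × ZMod d) := by
      rintro c d (rfl | rfl) (rfl | rfl)
      · exact hasLargeTripleFamily_prod_self
      · exact hasLargeTripleFamily_zmod_three_prod_nine
      · exact hasLargeTripleFamily_zmod_three_prod_nine.swap
      · exact hasLargeTripleFamily_prod_self
    have step : ∀ {c : ℕ}, (c = 3 ∨ c = 9) → HasLargeTripleFamily (ZMod b × ZMod c) := by
      intro c hc
      by_cases hb9 : b = 9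
      · exact h39 (Or.inr hb9) hc
      · exact HasLargeTripleFamily.lift_of_mod (Or.inr rfl) (by omega) hb9
          (by rcases hc with rfl | rfl <;> decide) (h39 (Or.inl rfl) hc)
    by_cases ha9 : a = 9
    · exact (step (Or.inr ha9)).swap
    · exact HasLargeTripleFamily.lift_of_mod (Or.inr rfl) (by omega) ha9 hb (step (Or.inl rfl)).swap
  · exact key ha hb ha3 hb3 h91
  · exact (key hb ha hb3 ha3 (by omega)).swap
  · have h1 : ∀ {c d : ℕ}, c % 6 = 1 → d % 2 = 1 → d % 3 ≠ 0 →
        HasLargeTripleFamily (ZMod c × ZMod d) := by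
      intro c d hc hd hd3
      have hd := Nat.odd_iff.mpr hd
      exact HasLargeTripleFamily.lift_of_mod (Or.inl rfl) hc (by omega) hd
        (hasLargeTripleFamily_zmod_prod_of_coprime odd_one hd (Nat.coprime_one_left d) (by omega))
    by_cases ha1 : a % 6 = 1
    · exact h1 ha1 hb2 hb3
    by_cases hb1 : b % 6 = 1
    · exact (h1 hb1 ha2 ha3).swap
    obtain ⟨p, hp, hp5, hpa⟩ := exists_prime_dvd_mod_six_eq_five a (by omega)
    obtain ⟨q, hq, hq5, hqb⟩ := exists_prime_dvd_mod_six_eq_five b (by omega)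
    have hcof : ∀ {c s : ℕ}, c % 6 = 5 → c * s % 6 = 5 → s % 6 = 1 := by
      intro c s hc hcs
      rw [Nat.mul_mod, hc] at hcs
      omega
    obtain ⟨s, rfl⟩ := hpa
    obtain ⟨t, rfl⟩ := hqb
    have hs := hcof (s := s) hp5 (by omega)
    have ht := hcof (s := t) hq5 (by omega)
    have hpq : HasLargeTripleFamily (ZMod q × ZMod p) := by
      by_cases h : q = p
      · subst h
        have : NeZero q := ⟨hq.ne_zero⟩
        exact hasLargeTripleFamily_prod_self
      · refine hasLargeTripleFamily_zmod_prod_of_coprime (Nat.odd_iff.mpr (by omega))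
          (Nat.odd_iff.mpr (by omega)) ((Nat.coprime_primes hq hp).mpr h) ?_
        have := Nat.mul_mod q p 6
        rw [hp5, hq5] at this
        omega
    have h2 := HasLargeTripleFamily.lift (r := 1) (g := t) (c := q) (b := p) (Or.inl rfl)
      (by omega) (by omega) (Nat.odd_iff.mpr (by omega)) (Nat.odd_iff.mpr (by omega))
      (by rwa [one_mul])
    rw [one_mul, mul_comm t q] at h2
    have h3 := HasLargeTripleFamily.lift (r := 1) (g := s) (c := p) (b := q * t) (Or.inl rfl)
      (by omega) (by omega) (Nat.odd_iff.mpr (by omega)) hb (by rw [one_mul]; exact h2.swap)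
    rwa [one_mul, mul_comm s p] at h3

/-- A family of triples in `G` in which distinct members have no common nonzero difference. -/
def IsTripleCode {G : Type} [AddCommGroup G] (F : Finset (Finset G)) : Prop :=
  (∀ X ∈ F, #X = 3) ∧ ∀ X ∈ F, ∀ Y ∈ F, X ≠ Y → ∀ x ∈ X, ∀ y ∈ X, ∀ x' ∈ Y, ∀ y' ∈ Y,
    x - y = x' - y' → x = y

theorem oospc_iff_isTripleCode {m n : ℕ} {F : Finset (Finset (ZMod m × ZMod n))} :
    OOSPC m n 3 3 1 F ↔ IsTripleCode F := by
  constructor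
  · rintro ⟨h1, -, h3⟩
    refine ⟨h1, fun X hX Y hY hXY x hx y hy x' hx' y' hy' h => ?_⟩
    refine card_le_one.mp (h3 X hX Y hY hXY (x - x')) x ?_ y ?_
    · exact mem_inter.mpr ⟨hx, mem_image.mpr ⟨x', hx', by abel⟩⟩
    · refine mem_inter.mpr ⟨hy, mem_image.mpr ⟨y', hy', ?_⟩⟩
      rw [sub_eq_sub_iff_add_eq_add] at h
      rw [sub_add_eq_add_sub, sub_eq_iff_eq_add, h, add_comm]
  · rintro ⟨h1, h2⟩
    refine ⟨h1, fun X hX g _ => (card_le_card inter_subset_left).trans (h1 X hX).le,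
      fun X hX Y hY hXY g => card_le_one.mpr fun x hx y hy => ?_⟩
    obtain ⟨hx, hxY⟩ := mem_inter.mp hx
    obtain ⟨hy, hyY⟩ := mem_inter.mp hy
    obtain ⟨x', hx', rfl⟩ := mem_image.mp hxY
    obtain ⟨y', hy', rfl⟩ := mem_image.mp hyY
    exact h2 X hX Y hY hXY _ hx _ hy x' hx' y' hy' (by abel)

theorem IsTripleCode.map {G G' : Type} [AddCommGroup G] [AddCommGroup G'] (e : G ≃+ G')
    {F : Finset (Finset G)} (hF : IsTripleCode F) :
    IsTripleCode (F.map (mapEmbedding e.toEquiv.toEmbedding).toEmbedding) := by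
  simp only [IsTripleCode, Finset.mem_map]
  constructor
  · rintro _ ⟨X, hX, rfl⟩
    simpa using hF.1 X hX
  · rintro _ ⟨X, hX, rfl⟩ _ ⟨Y, hY, rfl⟩ hXY
    have hne : X ≠ Y := fun h => hXY (by rw [h])
    simp only [RelEmbedding.coe_toEmbedding, mapEmbedding_apply, Finset.mem_map,
      Equiv.coe_toEmbedding]
    rintro _ ⟨x, hx, rfl⟩ _ ⟨y, hy, rfl⟩ _ ⟨x', hx', rfl⟩ _ ⟨y', hy', rfl⟩ h
    have h : e (x - y) = e (x' - y') := by simpa using h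
    rw [hF.2 X hX Y hY hne x hx y hy x' hx' y' hy' (e.injective h)]

theorem eq_or_eq_neg_symm {H : Type*} [InvolutiveNeg H] {x y : H} (h : x = y ∨ x = -y) :
    y = x ∨ y = -x :=
  h.imp Eq.symm fun h => neg_eq_iff_eq_neg.mp h.symm

/-- Triples can be prescribed by their differences. -/
theorem exists_isTripleCode_of_differences {ι G : Type} [Finite ι] [AddCommGroup G]
    (D : ι → Fin 3 → G) (hsum : ∀ i, D i 0 + D i 1 + D i 2 = 0) (hne : ∀ i j, D i j ≠ 0)
    (hD : ∀ i j i' j', (D i j = D i' j' ∨ D i j = -D i' j') → i = i') :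
    ∃ F : Finset (Finset G), IsTripleCode F ∧ #F = Nat.card ι := by
  classical
  have := Fintype.ofFinite ι
  let B : ι → Finset G := fun i => {0, D i 0, D i 0 + D i 1}
  have hB : ∀ i x, x ∈ B i ↔ x = 0 ∨ x = D i 0 ∨ x = D i 0 + D i 1 := fun i x => by simp [B]
  have h2 : ∀ i, D i 0 + D i 1 = -D i 2 := fun i => eq_neg_of_add_eq_zero_left (hsum i)
  have hdiff : ∀ i, ∀ x ∈ B i, ∀ y ∈ B i, x ≠ y → ∃ j, x - y = D i j ∨ x - y = -D i j := by
    intro i x hx y hy hxy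
    rw [hB] at hx hy
    rcases hx with rfl | rfl | rfl <;> rcases hy with rfl | rfl | rfl
    · exact absurd rfl hxy
    · exact ⟨0, Or.inr (zero_sub _)⟩
    · exact ⟨2, Or.inl (by rw [h2, sub_neg_eq_add, zero_add])⟩
    · exact ⟨0, Or.inl (sub_zero _)⟩
    · exact absurd rfl hxy
    · exact ⟨1, Or.inr (by abel)⟩
    · exact ⟨2, Or.inr (by rw [h2, sub_zero])⟩
    · exact ⟨1, Or.inl (by abel)⟩
    · exact absurd rfl hxy
  have hcross : ∀ i i', ∀ x ∈ B i, ∀ y ∈ B i, ∀ x' ∈ B i', ∀ y' ∈ B i', x - y = x' - y' →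
      x ≠ y → i = i' := by
    intro i i' x hx y hy x' hx' y' hy' h hxy
    obtain ⟨j, hj⟩ := hdiff i x hx y hy hxy
    obtain ⟨j', hj'⟩ := hdiff i' x' hx' y' hy' (by
      rintro rfl
      rw [sub_self, sub_eq_zero] at h
      exact hxy h)
    refine hD i j i' j' ?_
    rw [h] at hj
    rcases hj with hj | hj <;> rcases hj' with hj' | hj' <;> rw [hj] at hj'
    · exact Or.inl hj'
    · exact Or.inr hj'
    · exact Or.inr (neg_eq_iff_eq_neg.mp hj')
    · exact Or.inl (neg_inj.mp hj')
  have hinj : Function.Injective B := by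
    intro i i' h
    have h0 : (0 : G) ∈ B i := by simp [B]
    have h1 : D i 0 ∈ B i := by simp [B]
    exact hcross i i' _ h1 _ h0 _ (h ▸ h1) _ (h ▸ h0) rfl (hne i 0)
  refine ⟨univ.image B, ⟨fun X hX => ?_, fun X hX Y hY hXY => ?_⟩, ?_⟩
  · obtain ⟨i, -, rfl⟩ := mem_image.mp hX
    refine card_eq_three.mpr ⟨0, D i 0, D i 0 + D i 1, (hne i 0).symm, ?_, ?_, rfl⟩
    · rw [h2]
      exact (neg_ne_zero.mpr (hne i 2)).symm
    · simpa using hne i 1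
  · obtain ⟨i, -, rfl⟩ := mem_image.mp hX
    obtain ⟨i', -, rfl⟩ := mem_image.mp hY
    intro x hx y hy x' hx' y' hy' h
    by_contra hxy
    exact hXY (by rw [hcross i i' x hx y hy x' hx' y' hy' h hxy])
  · rw [card_image_of_injective _ hinj, card_univ, Nat.card_eq_fintype_card]

/-- The three involutions of the Klein four-group. -/
def kleinInvolution : Fin 3 → ZMod 2 × ZMod 2 := ![(1, 0), (0, 1), (1, 1)]

theorem exists_isTripleCode_of_coloring {μ R T H : Type} [Finite μ] [Finite R] [Finite T]
    [AddCommGroup H] (hH : Odd (Nat.card H))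
    (y : μ → Fin 3 → H) (hy0 : ∀ i, y i 0 + y i 1 + y i 2 = 0)
    (hy : ∀ i i' j, (y i j = y i' j ∨ y i j = -y i' j) → i = i')
    (r : R → H) (hr3 : ∀ a, 3 • r a ≠ 0) (hr : ∀ a b, (r a = r b ∨ r a = -r b) → a = b)
    (c : R → Fin 3) (hc : ∀ a i, ¬ (r a = y i (c a) ∨ r a = -y i (c a)))
    (τ : T → H) (hτ0 : ∀ t, τ t ≠ 0) (hτ3 : ∀ t, 3 • τ t = 0)
    (hτ : ∀ s t, (τ s = τ t ∨ τ s = -τ t) → s = t) :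
    ∃ F : Finset (Finset ((ZMod 2 × ZMod 2) × H)), IsTripleCode F ∧
      #F = Nat.card μ + Nat.card R + Nat.card T := by
  set e := kleinInvolution with he
  have he0 : ∀ j, e j ≠ 0 := by decide
  have heinj : ∀ j j', e j = e j' → j = j' := by decide
  have hesum : e 0 + e 1 + e 2 = 0 := by decide
  have hadd : ∀ v : ZMod 2 × ZMod 2, v + v = 0 := by decide
  have hneg : ∀ v : ZMod 2 × ZMod 2, -v = v := by decide
  have hor : ∀ {u v : ZMod 2 × ZMod 2} {x x' : H}, ((u, x) = (v, x') ∨ (u, x) = -(v, x')) →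
      u = v ∧ (x = x' ∨ x = -x') := by
    rintro u v x x' (h | h)
    · exact ⟨congrArg Prod.fst h, Or.inl (congrArg Prod.snd h)⟩
    · exact ⟨(congrArg Prod.fst h).trans (hneg v), Or.inr (congrArg Prod.snd h)⟩
  have hr0 : ∀ a, r a + r a ≠ 0 := fun a h => hr3 a (by
    rw [eq_zero_of_add_self_eq_zero hH h, smul_zero])
  let D : (μ ⊕ R) ⊕ T → Fin 3 → (ZMod 2 × ZMod 2) × H := Sum.elim (Sum.elim (fun i j => (e j, y i j))
    (fun a => ![(e (c a), r a), (e (c a), r a), (0, -(r a + r a))])) (fun t _ => (0, τ t))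
  have hDR : ∀ a j, D (Sum.inl (Sum.inr a)) j = (e (c a), r a) ∨
      D (Sum.inl (Sum.inr a)) j = (0, -(r a + r a)) := by
    intro a j
    fin_cases j
    · exact Or.inl rfl
    · exact Or.inl rfl
    · exact Or.inr rfl
  have hμR : ∀ i a j j', ¬ (D (Sum.inl (Sum.inl i)) j = D (Sum.inl (Sum.inr a)) j' ∨
      D (Sum.inl (Sum.inl i)) j = -D (Sum.inl (Sum.inr a)) j') := by
    intro i a j j' h
    rcases hDR a j' with h' | h' <;> rw [h'] at h <;> obtain ⟨h1, h2⟩ := hor h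
    · obtain rfl := heinj _ _ h1
      exact hc a i (eq_or_eq_neg_symm h2)
    · exact he0 j h1
  have hμT : ∀ i t j j', ¬ (D (Sum.inl (Sum.inl i)) j = D (Sum.inr t) j' ∨
      D (Sum.inl (Sum.inl i)) j = -D (Sum.inr t) j') :=
    fun i t j j' h => he0 j (hor h).1
  have hRT : ∀ a t j j', ¬ (D (Sum.inl (Sum.inr a)) j = D (Sum.inr t) j' ∨
      D (Sum.inl (Sum.inr a)) j = -D (Sum.inr t) j') := by
    intro a t j j' h
    rcases hDR a j with h' | h' <;> rw [h'] at h <;> obtain ⟨h1, h2⟩ := hor h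
    · exact he0 _ h1
    · have h3 : 3 • -(r a + r a) = 0 := by
        rcases h2 with h2 | h2 <;> rw [h2]
        · exact hτ3 t
        · rw [smul_neg, hτ3, neg_zero]
      rw [smul_neg, neg_eq_zero, smul_add] at h3
      exact hr3 a (eq_zero_of_add_self_eq_zero hH h3)
  rw [← Nat.card_sum, ← Nat.card_sum]
  refine exists_isTripleCode_of_differences D ?_ ?_ ?_
  · rintro ((i | a) | t)
    · exact Prod.ext hesum (hy0 i)
    · refine Prod.ext ?_ ?_
      · simp [D, hadd]
      · simp [D]
    · refine Prod.ext ?_ ?_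
      · simp [D]
      · have := hτ3 t
        simp only [D, Sum.elim_inr, Prod.snd_add, Prod.snd_zero]
        rw [← this]
        abel
  · rintro ((i | a) | t) j h
    · exact he0 j (congrArg Prod.fst h)
    · rcases hDR a j with h' | h' <;> rw [h'] at h
      · exact he0 _ (congrArg Prod.fst h)
      · exact hr0 a (neg_eq_zero.mp (congrArg Prod.snd h))
    · exact hτ0 t (congrArg Prod.snd h)
  · rintro ((i | a) | t) j ((i' | a') | t') j' h
    · obtain ⟨h1, h2⟩ := hor h
      obtain rfl := heinj _ _ h1
      rw [hy i i' j h2]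
    · exact absurd h (hμR _ _ _ _)
    · exact absurd h (hμT _ _ _ _)
    · exact absurd (eq_or_eq_neg_symm h) (hμR _ _ _ _)
    · rcases hDR a j with h' | h' <;> rcases hDR a' j' with h'' | h'' <;> rw [h', h''] at h <;>
        obtain ⟨h1, h2⟩ := hor h
      · rw [hr a a' h2]
      · exact absurd h1 (he0 _)
      · exact absurd h1.symm (he0 _)
      · rw [hr a a']
        rcases h2 with h2 | h2
        · left
          refine sub_eq_zero.mp (eq_zero_of_add_self_eq_zero hH ?_)
          rw [sub_add_sub_comm, neg_inj.mp h2, sub_self]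
        · right
          refine eq_neg_iff_add_eq_zero.mpr (eq_zero_of_add_self_eq_zero hH ?_)
          rw [neg_neg, neg_eq_iff_add_eq_zero] at h2
          rw [← h2]
          abel
    · exact absurd h (hRT _ _ _ _)
    · exact absurd (eq_or_eq_neg_symm h) (hμT _ _ _ _)
    · exact absurd (eq_or_eq_neg_symm h) (hRT _ _ _ _)
    · rw [hτ t t' (hor h).2]

theorem exists_isTripleCode_of_isTripleFamily {κ ε H : Type} [Finite κ] [Finite ε] [AddCommGroup H]
    (hH : Odd (Nat.card H)) {f : κ → Fin 3 → H} (hf : IsTripleFamily f) {L T : Finset H}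
    (hL3 : ∀ l ∈ L, 3 • l ≠ 0) (hLf : ∀ l ∈ L, ∀ k j, ¬ (l = f k j ∨ l = -f k j))
    (hL : ∀ l ∈ L, ∀ l' ∈ L, (l = l' ∨ l = -l') → l = l')
    (hT3 : ∀ t ∈ T, 3 • t = 0 ∧ t ≠ 0) (hT : ∀ s ∈ T, ∀ t ∈ T, (s = t ∨ s = -t) → s = t)
    {y : ε → Fin 3 → H} (hy0 : ∀ i, y i 0 + y i 1 + y i 2 = 0)
    (hy : ∀ i i' j, (y i j = y i' j ∨ y i j = -y i' j) → i = i')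
    (hyL : ∀ i j, y i j = 0 ∨ ∃ l ∈ L, y i j = l ∨ y i j = -l) {c : H → Fin 3}
    (hc : ∀ l ∈ L, ∀ i, ¬ (l = y i (c l) ∨ l = -y i (c l))) :
    ∃ F : Finset (Finset ((ZMod 2 × ZMod 2) × H)), IsTripleCode F ∧
      #F = 5 * Nat.card κ + #L + 2 * #T + Nat.card ε := by
  obtain ⟨hf0, hf3, hfd⟩ := hf
  have tors : ∀ {x z : H}, 3 • z = 0 → (x = z ∨ x = -z) → 3 • x = 0 := by
    rintro x z hz (rfl | rfl)
    · exact hz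
    · rw [smul_neg, hz, neg_zero]
  have hfT : ∀ k j, ∀ t ∈ T, ¬ (f k j = t ∨ f k j = -t) := fun k j t ht h =>
    hf3 k j (tors (hT3 t ht).1 h)
  have trans : ∀ {x z l : H}, (x = z ∨ x = -z) → (z = l ∨ z = -l) → x = l ∨ x = -l := by
    rintro x z l (rfl | rfl) (rfl | rfl) <;> simp
  have hfy : ∀ k j i j', ¬ (f k j = y i j' ∨ f k j = -y i j') := by
    intro k j i j' h
    rcases hyL i j' with h0 | ⟨l, hl, hl'⟩
    · exact hf3 k j (tors (by rw [h0, smul_zero]) h)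
    · exact hLf l hl k j (eq_or_eq_neg_symm (trans h hl'))
  have hTy : ∀ t ∈ T, ∀ i j, ¬ (t = y i j ∨ t = -y i j) := by
    intro t ht i j h
    rcases hyL i j with h0 | ⟨l, hl, hl'⟩
    · refine (hT3 t ht).2 ?_
      rcases h with h | h <;> rw [h, h0]
      exact neg_zero
    · exact hL3 l hl (tors (hT3 t ht).1 (eq_or_eq_neg_symm (trans h hl')))
  have hLT : ∀ l ∈ L, ∀ t ∈ T, ¬ (l = t ∨ l = -t) := fun l hl t ht h =>
    hL3 l hl (tors (hT3 t ht).1 h)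
  let s : Bool → Fin 3 := fun b => bif b then 1 else 0
  have hs : ∀ j b b', j + s b = j + s b' → b = b' := by decide
  have hs' : ∀ j b, j ≠ j + 1 + s b := by decide
  let Y : (κ × Bool ⊕ T) ⊕ ε → Fin 3 → H :=
    Sum.elim (Sum.elim (fun p j => f p.1 (j + s p.2)) (fun t _ => t)) y
  let r : κ × Fin 3 ⊕ L → H := Sum.elim (fun p => f p.1 p.2) (fun l => l)
  let col : κ × Fin 3 ⊕ L → Fin 3 := Sum.elim (fun p => p.2 + 1) (fun l => c l)
  obtain ⟨F, hF, hcard⟩ := exists_isTripleCode_of_coloring (μ := (κ × Bool ⊕ T) ⊕ ε)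
    (R := κ × Fin 3 ⊕ L) (T := T) hH Y (by
      rintro ((⟨k, b⟩ | t) | i)
      · cases b
        · exact hf0 k
        · change f k 1 + f k 2 + f k 0 = 0
          rw [← hf0 k]
          abel
      · change (t : H) + t + t = 0
        rw [← (hT3 t t.2).1]
        abel
      · exact hy0 i) (by
      rintro ((⟨k, b⟩ | t) | i) ((⟨k', b'⟩ | t') | i') j h
      · obtain ⟨rfl, h⟩ := hfd _ _ _ _ h
        obtain rfl : b = b' := hs _ _ _ h
        rfl
      · exact absurd h (hfT _ _ _ t'.2)
      · exact absurd h (hfy _ _ _ _)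
      · exact absurd (eq_or_eq_neg_symm h) (hfT _ _ _ t.2)
      · rw [Subtype.ext (hT t t.2 t' t'.2 h)]
      · exact absurd h (hTy _ t.2 _ _)
      · exact absurd (eq_or_eq_neg_symm h) (hfy _ _ _ _)
      · exact absurd (eq_or_eq_neg_symm h) (hTy _ t'.2 _ _)
      · rw [hy i i' j h]) r (by
      rintro (⟨k, j⟩ | l)
      · exact hf3 k j
      · exact hL3 l l.2) (by
      rintro (⟨k, j⟩ | l) (⟨k', j'⟩ | l') h
      · obtain ⟨rfl, rfl⟩ := hfd _ _ _ _ h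
        rfl
      · exact absurd (eq_or_eq_neg_symm h) (hLf _ l'.2 _ _)
      · exact absurd h (hLf _ l.2 _ _)
      · rw [Subtype.ext (hL l l.2 l' l'.2 h)]) col (by
      rintro (⟨k, j⟩ | l) ((⟨k', b⟩ | t) | i) h
      · exact hs' _ _ (hfd _ _ _ _ h).2
      · exact hfT _ _ _ t.2 h
      · exact hfy _ _ _ _ h
      · exact hLf _ l.2 _ _ h
      · exact hLT _ l.2 _ t.2 h
      · exact hc l l.2 i h) (fun t => (t : H)) (fun t => (hT3 t t.2).2) (fun t => (hT3 t t.2).1)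
      (fun t t' h => Subtype.ext (hT t t.2 t' t'.2 h))
  refine ⟨F, hF, ?_⟩
  rw [hcard]
  simp only [Nat.card_sum, Nat.card_prod, Nat.card_eq_fintype_card (α := Bool), Fintype.card_bool,
    Nat.card_eq_fintype_card (α := Fin 3), Fintype.card_fin, Nat.card_eq_fintype_card (α := T),
    Nat.card_eq_fintype_card (α := L), Fintype.card_coe]
  ring

/-- A set of triples in `V × H`, where `V` is the Klein four-group, of the largest size allowed by
counting differences. -/
def HasLargeTripleCode (H : Type) [AddCommGroup H] : Prop :=
  ∃ F : Finset (Finset ((ZMod 2 × ZMod 2) × H)), IsTripleCode F ∧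
    5 * Nat.card H + threeTorsionCard H ≤ 6 * #F + 5

theorem HasLargeTripleCode.congr {H H' : Type} [AddCommGroup H] [AddCommGroup H'] (e : H ≃+ H')
    (h : HasLargeTripleCode H) : HasLargeTripleCode H' := by
  obtain ⟨F, hF, hcard⟩ := h
  refine ⟨_, hF.map (AddEquiv.prodCongr (AddEquiv.refl _) e), ?_⟩
  rwa [card_map, ← Nat.card_congr e.toEquiv, ← threeTorsionCard_congr e]

theorem HasLargeTripleFamily.hasLargeTripleCode {H : Type} [AddCommGroup H] [Finite H]
    (hH : Odd (Nat.card H)) (h : HasLargeTripleFamily H) : HasLargeTripleCode H := by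
  classical
  have := Fintype.ofFinite H
  obtain ⟨κ, hκ, f, hf, hcard⟩ := h
  have := Fintype.ofFinite κ
  have half : ∀ S : Finset H, ∃ T ⊆ S, (∀ s ∈ T, ∀ t ∈ T, (s = t ∨ s = -t) → s = t) ∧
      #S ≤ 2 * #T := by
    intro S
    obtain ⟨T, hTS, hT, hc⟩ := exists_separated_subset (fun x : H => {x, -x}) 2
      (fun x => card_le_two) (fun x => by simp) (fun x y h => by
        simp only [mem_insert, mem_singleton] at h ⊢
        exact eq_or_eq_neg_symm h) S
    refine ⟨T, hTS, fun s hs t ht h => hT s hs t ht ?_, hc⟩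
    simp only [mem_insert, mem_singleton]
    exact eq_or_eq_neg_symm h
  let C : Finset H := univ.image fun p : κ × Fin 3 × Bool => bif p.2.2 then f p.1 p.2.1 else -f p.1 p.2.1
  have hC : #C ≤ 6 * Nat.card κ := by
    refine card_image_le.trans ?_
    rw [card_univ, Fintype.card_prod, Fintype.card_prod, Fintype.card_fin, Fintype.card_bool,
      Nat.card_eq_fintype_card, mul_comm]
  let Z : Finset H := {x | 3 • x = 0}
  have hZ : #Z = threeTorsionCard H := by
    rw [threeTorsionCard, Nat.card_eq_fintype_card, Fintype.card_subtype]
  have hZ0 : #(Z.erase 0) = #Z - 1 := card_erase_of_mem (by simp [Z])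
  obtain ⟨L, hLS, hL, hLc⟩ := half (univ \ (Z ∪ C))
  obtain ⟨T, hTS, hT, hTc⟩ := half (Z.erase 0)
  have hcount : Nat.card H ≤ #Z + #C + #(univ \ (Z ∪ C)) := by
    rw [Nat.card_eq_fintype_card, ← card_univ, ← card_sdiff_add_card_eq_card (subset_univ (Z ∪ C))]
    have := card_union_le Z C
    omega
  have hL3 : ∀ l ∈ L, 3 • l ≠ 0 := fun l hl h => by
    have := hLS hl
    simp [Z, h] at this
  have hLf : ∀ l ∈ L, ∀ k j, ¬ (l = f k j ∨ l = -f k j) := by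
    intro l hl k j h
    have hl := (mem_sdiff.mp (hLS hl)).2
    refine hl (mem_union_right _ (mem_image.mpr ?_))
    rcases h with rfl | rfl
    · exact ⟨(k, j, true), mem_univ _, rfl⟩
    · exact ⟨(k, j, false), mem_univ _, rfl⟩
  have hT3 : ∀ t ∈ T, 3 • t = 0 ∧ t ≠ 0 := fun t ht => by
    have := hTS ht
    simp only [Z, mem_erase, mem_filter, mem_univ, true_and] at this
    exact this.symm
  have hL0 : ∀ l ∈ L, l ≠ 0 := fun l hl h => hL3 l hl (by rw [h, smul_zero])
  have hneg0 : ∀ l ∈ L, ¬ (l = 0 ∨ l = -0) := fun l hl h => hL0 l hl (by simpa using h)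
  rcases le_or_gt #L 1 with h1 | h1
  · obtain ⟨F, hF, hFc⟩ := exists_isTripleCode_of_isTripleFamily (ε := Unit) hH hf hL3 hLf hL hT3 hT
      (y := fun _ _ => 0) (by simp) (by simp) (fun _ _ => Or.inl rfl) (c := fun _ => 0)
      (fun l hl _ => hneg0 l hl)
    refine ⟨F, hF, ?_⟩
    rw [Nat.card_eq_fintype_card (α := Unit), Fintype.card_unit] at hFc
    omega
  · obtain ⟨u, hu, v, hv, huv⟩ := one_lt_card.mp h1
    have huv' : ¬ (u = v ∨ u = -v) := fun h => huv (hL u hu v hv h)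
    have hvu' : ¬ (v = u ∨ v = -u) := fun h => huv' (eq_or_eq_neg_symm h)
    obtain ⟨F, hF, hFc⟩ := exists_isTripleCode_of_isTripleFamily (ε := Fin 2) hH hf hL3 hLf hL hT3
      hT (y := ![![0, u, -u], ![v, 0, -v]]) (by
        intro i
        fin_cases i <;> simp) (by
        have hu0 := hL0 u hu
        have hv0 := hL0 v hv
        intro i i' j h
        fin_cases i <;> fin_cases i' <;> first | rfl | skip
        all_goals
          exfalso
          fin_cases j <;> simp [eq_comm] at h <;> tauto) (by
        intro i j
        fin_cases i <;> fin_cases j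
        · exact Or.inl rfl
        · exact Or.inr ⟨u, hu, Or.inl rfl⟩
        · exact Or.inr ⟨u, hu, Or.inr rfl⟩
        · exact Or.inr ⟨v, hv, Or.inl rfl⟩
        · exact Or.inl rfl
        · exact Or.inr ⟨v, hv, Or.inr rfl⟩)
      (c := fun l => if l = u then 0 else if l = v then 1 else 2) (by
        intro l hl i
        by_cases hlu : l = u
        · subst hlu
          fin_cases i
          · simpa using hL0 l hu
          · simpa using huv'
        by_cases hlv : l = v
        · subst hlv
          fin_cases i
          · simpa [hlu] using hvu'
          · simpa [hlu] using hL0 l hv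
        · have h1 := fun h => hlu (hL l hl u hu h)
          have h2 := fun h => hlv (hL l hl v hv h)
          fin_cases i
          · simpa [hlu, hlv, or_comm] using h1
          · simpa [hlu, hlv, or_comm] using h2)
    refine ⟨F, hF, ?_⟩
    rw [Nat.card_eq_fintype_card (α := Fin 2), Fintype.card_fin] at hFc
    omega

theorem hasLargeTripleCode_zmod_nine : HasLargeTripleCode (ZMod 9) := by
  obtain ⟨F, hF, hcard⟩ := exists_isTripleCode_of_coloring (μ := Fin 4) (R := Fin 3) (T := Unit)
    (H := ZMod 9) (by rw [Nat.card_zmod]; decide)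
    ![![-3, 1, 2], ![1, 3, -4], ![2, 4, 3], ![0, 0, 0]] (by decide) (by decide)
    ![1, 2, 4] (by decide) (by decide) ![2, 1, 0] (by decide) (fun _ => 3) (by decide) (by decide)
    (fun _ _ _ => rfl)
  refine ⟨F, hF, ?_⟩
  simp only [Nat.card_eq_fintype_card, Fintype.card_fin, Fintype.card_unit] at hcard
  rw [hcard, threeTorsionCard_zmod, Nat.card_zmod]
  norm_num

theorem hasLargeTripleCode_zmod_prod {a b : ℕ} (ha : Odd a) (hb : Odd b) :
    HasLargeTripleCode (ZMod a × ZMod b) := by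
  have : NeZero a := ⟨ha.pos.ne'⟩
  have : NeZero b := ⟨hb.pos.ne'⟩
  by_cases h19 : a = 1 ∧ b = 9
  · obtain ⟨rfl, rfl⟩ := h19
    exact hasLargeTripleCode_zmod_nine.congr AddEquiv.uniqueProd.symm
  by_cases h91 : a = 9 ∧ b = 1
  · obtain ⟨rfl, rfl⟩ := h91
    exact hasLargeTripleCode_zmod_nine.congr AddEquiv.prodUnique.symm
  refine (hasLargeTripleFamily_zmod_prod ha hb h19 h91).hasLargeTripleCode ?_
  rw [Nat.card_prod, Nat.card_zmod, Nat.card_zmod]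
  exact ha.mul hb

open Classical in
/-- The weight of a difference in `V × H`, where `V` is the Klein four-group. -/
noncomputable def differenceWeight {H : Type} [AddCommGroup H] (d : (ZMod 2 × ZMod 2) × H) : ℕ :=
  if d.1 = 0 then if d.2 = 0 then 0 else if 3 • d.2 = 0 then 3 else 2
  else if d.2 = 0 then 2 else 1

theorem sum_differenceWeight (H : Type) [AddCommGroup H] [Fintype H] :
    ∑ d : (ZMod 2 × ZMod 2) × H, differenceWeight d = 5 * Nat.card H + threeTorsionCard H := by
  classical
  have h : ∀ x : H, ∑ v : ZMod 2 × ZMod 2, differenceWeight (v, x) =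
      5 + if 3 • x = 0 then 1 else 0 := by
    intro x
    have huniv : (univ : Finset (ZMod 2 × ZMod 2)) = {(0, 0), (1, 0), (0, 1), (1, 1)} := by decide
    rw [huniv, sum_insert (by decide), sum_insert (by decide), sum_insert (by decide),
      sum_singleton]
    have h1 : ((1, 0) : ZMod 2 × ZMod 2) ≠ 0 := by decide
    have h2 : ((0, 1) : ZMod 2 × ZMod 2) ≠ 0 := by decide
    have h3 : ((1, 1) : ZMod 2 × ZMod 2) ≠ 0 := by decide
    have h0 : ((0, 0) : ZMod 2 × ZMod 2) = 0 := rfl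
    simp only [differenceWeight, h0, h1, h2, h3, if_true, if_false]
    by_cases hx : x = 0
    · simp [hx]
    · by_cases hx3 : 3 • x = 0 <;> simp [hx, hx3]
  rw [Fintype.sum_prod_type_right]
  simp only [h]
  rw [sum_add_distrib, sum_const, card_univ, smul_eq_mul, mul_comm, ← card_filter, threeTorsionCard,
    Nat.card_eq_fintype_card, Nat.card_eq_fintype_card (α := {x : H // 3 • x = 0}),
    Fintype.card_subtype]

theorem six_le_sum_differenceWeight {H : Type} [AddCommGroup H] (hH : Odd (Nat.card H))
    {S : Finset ((ZMod 2 × ZMod 2) × H)} (hS : ∀ d ∈ S, -d ∈ S) {a b c : (ZMod 2 × ZMod 2) × H}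
    (ha : a ∈ S) (hb : b ∈ S) (hc : c ∈ S) (habc : a + b + c = 0) (ha0 : a ≠ 0) (hb0 : b ≠ 0)
    (hc0 : c ≠ 0) : 6 ≤ ∑ d ∈ S, differenceWeight d := by
  classical
  have hneg : ∀ v : ZMod 2 × ZMod 2, -v = v := by decide
  let P : (ZMod 2 × ZMod 2) × H → Finset ((ZMod 2 × ZMod 2) × H) := fun d => {d, -d}
  have hP : ∀ d e, e ∈ P d ↔ e = d ∨ e = -d := fun d e => by simp [P]
  have hPS : ∀ d ∈ S, P d ⊆ S := by
    intro d hd e he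
    rcases (hP d e).mp he with rfl | rfl
    · exact hd
    · exact hS d hd
  have hdisj : ∀ d e, ¬ (d = e ∨ d = -e) → Disjoint (P d) (P e) := by
    intro d e h
    rw [disjoint_left]
    intro x hx hx'
    rw [hP] at hx hx'
    rcases hx with rfl | rfl
    · exact h hx'
    · exact h (by rwa [neg_eq_iff_eq_neg, neg_inj, or_comm] at hx')
  have hdisj1 : ∀ d e, d.1 ≠ e.1 → Disjoint (P d) (P e) := by
    refine fun d e h => hdisj d e ?_
    rintro (h' | h')
    · exact h (congrArg Prod.fst h')
    · exact h ((congrArg Prod.fst h').trans (hneg _))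
  have hpair : ∀ d : (ZMod 2 × ZMod 2) × H, d.2 ≠ 0 → ∀ k, k ≤ differenceWeight d →
      k ≤ differenceWeight (-d) → 2 * k ≤ ∑ e ∈ P d, differenceWeight e := by
    intro d hd k h1 h2
    have hne : d ≠ -d := fun h => hd (eq_zero_of_add_self_eq_zero hH
      (eq_neg_iff_add_eq_zero.mp (congrArg Prod.snd h)))
    rw [sum_pair hne]
    omega
  have W2 : ∀ d, d.1 ≠ 0 → 2 ≤ ∑ e ∈ P d, differenceWeight e := by
    intro d hd
    by_cases hd2 : d.2 = 0
    · have : differenceWeight d = 2 := by simp [differenceWeight, hd, hd2]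
      exact this.ge.trans (single_le_sum_of_canonicallyOrdered (by simp [P]))
    · refine hpair d hd2 1 ?_ ?_ <;> simp [differenceWeight, hd, hd2]
  have hsnd : ∀ d : (ZMod 2 × ZMod 2) × H, d.1 = 0 → d ≠ 0 → d.2 ≠ 0 :=
    fun d h1 h h2 => h (Prod.ext h1 h2)
  have W4 : ∀ d, d.1 = 0 → d ≠ 0 → 4 ≤ ∑ e ∈ P d, differenceWeight e := by
    intro d hd hd0
    have hd2 := hsnd d hd hd0
    refine hpair d hd2 2 ?_ ?_ <;> simp only [differenceWeight, Prod.fst_neg, Prod.snd_neg,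
      neg_eq_zero, hd, hd2, if_true, if_false] <;> split <;> omega
  have W6 : ∀ d, d.1 = 0 → d ≠ 0 → 3 • d.2 = 0 → 6 ≤ ∑ e ∈ P d, differenceWeight e := by
    intro d hd hd0 hd3
    have hd2 := hsnd d hd hd0
    refine hpair d hd2 3 ?_ ?_ <;> simp [differenceWeight, hd, hd2, hd3]
  have two : ∀ d ∈ S, ∀ e ∈ S, Disjoint (P d) (P e) → ∑ x ∈ P d, differenceWeight x +
      ∑ x ∈ P e, differenceWeight x ≤ ∑ x ∈ S, differenceWeight x := by
    intro d hd e he h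
    rw [← sum_union h]
    exact sum_le_sum_of_subset (union_subset (hPS d hd) (hPS e he))
  have mixed : ∀ d ∈ S, ∀ e ∈ S, d ≠ 0 → d.1 = 0 → e.1 ≠ 0 →
      6 ≤ ∑ x ∈ S, differenceWeight x := by
    intro d hd e he hd0 hd1 he1
    have h1 := two d hd e he (hdisj1 d e (by rw [hd1]; exact he1.symm))
    have h2 := W4 d hd1 hd0
    have h3 := W2 e he1
    omega
  have trivial_class : ∀ d ∈ S, ∀ e ∈ S, d ≠ 0 → e ≠ 0 → d + e ≠ 0 → d.1 = 0 → e.1 = 0 → d ≠ e →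
      6 ≤ ∑ x ∈ S, differenceWeight x := by
    intro d hd e he hd0 he0 hde hd1 he1 hne
    have h1 := two d hd e he (hdisj d e (by
      rintro (h | h)
      · exact hne h
      · exact hde (eq_neg_iff_add_eq_zero.mp h)))
    have h2 := W4 d hd1 hd0
    have h3 := W4 e he1 he0
    omega
  have hbc : b + c ≠ 0 := fun h => ha0 (by rw [← habc, add_assoc, h, add_zero])
  have hab : a + b ≠ 0 := fun h => hc0 (by rw [← habc, h, zero_add])
  by_cases ha1 : a.1 = 0 <;> by_cases hb1 : b.1 = 0 <;> by_cases hc1 : c.1 = 0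
  · by_cases h1 : a = b
    · by_cases h2 : b = c
      · have h3 : 3 • a.2 = 0 := by
          subst h1 h2
          have h3 : a.2 + a.2 + a.2 = 0 := congrArg Prod.snd habc
          rw [← h3]
          abel
        exact (W6 a ha1 ha0 h3).trans (sum_le_sum_of_subset (hPS a ha))
      · exact trivial_class b hb c hc hb0 hc0 hbc hb1 hc1 h2
    · exact trivial_class a ha b hb ha0 hb0 hab ha1 hb1 h1
  · exact mixed b hb c hc hb0 hb1 hc1
  · exact mixed a ha b hb ha0 ha1 hb1
  · exact mixed a ha b hb ha0 ha1 hb1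
  · exact mixed c hc a ha hc0 hc1 ha1
  · exact mixed b hb c hc hb0 hb1 hc1
  · exact mixed c hc a ha hc0 hc1 ha1
  · have hadd : ∀ u v w : ZMod 2 × ZMod 2, u + v + w = 0 → u ≠ 0 → v ≠ 0 → w ≠ 0 →
        u ≠ v ∧ u ≠ w ∧ v ≠ w := by decide
    obtain ⟨h1, h2, h3⟩ := hadd a.1 b.1 c.1 (congrArg Prod.fst habc) ha1 hb1 hc1
    have hd : Disjoint (P a ∪ P b) (P c) :=
      disjoint_union_left.mpr ⟨hdisj1 a c h2, hdisj1 b c h3⟩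
    have h4 : ∑ x ∈ P a ∪ P b ∪ P c, differenceWeight x ≤ ∑ x ∈ S, differenceWeight x :=
      sum_le_sum_of_subset (union_subset (union_subset (hPS a ha) (hPS b hb)) (hPS c hc))
    rw [sum_union hd, sum_union (hdisj1 a b h1)] at h4
    have := W2 a ha1
    have := W2 b hb1
    have := W2 c hc1
    omega

theorem IsTripleCode.six_mul_card_le {H : Type} [AddCommGroup H] [Finite H]
    (hH : Odd (Nat.card H)) {F : Finset (Finset ((ZMod 2 × ZMod 2) × H))} (hF : IsTripleCode F) :
    6 * #F ≤ 5 * Nat.card H + threeTorsionCard H := by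
  classical
  have := Fintype.ofFinite H
  let Δ : Finset ((ZMod 2 × ZMod 2) × H) → Finset ((ZMod 2 × ZMod 2) × H) := fun X =>
    X.offDiag.image fun p => p.1 - p.2
  have hΔ : ∀ X, ∀ x ∈ X, ∀ y ∈ X, x ≠ y → x - y ∈ Δ X := fun X x hx y hy hxy =>
    mem_image.mpr ⟨(x, y), mem_offDiag.mpr ⟨hx, hy, hxy⟩, rfl⟩
  have hdisj : Set.PairwiseDisjoint (F : Set (Finset ((ZMod 2 × ZMod 2) × H))) Δ := by
    intro X hX Y hY hXY
    refine disjoint_left.mpr fun d hd hd' => ?_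
    obtain ⟨⟨x, y⟩, hp, rfl⟩ := mem_image.mp hd
    obtain ⟨⟨x', y'⟩, hp', h⟩ := mem_image.mp hd'
    obtain ⟨hx, hy, hxy⟩ := mem_offDiag.mp hp
    obtain ⟨hx', hy', -⟩ := mem_offDiag.mp hp'
    exact hxy (hF.2 X hX Y hY hXY x hx y hy x' hx' y' hy' h.symm)
  have hweight : ∀ X ∈ F, 6 ≤ ∑ d ∈ Δ X, differenceWeight d := by
    intro X hX
    obtain ⟨x, y, z, hxy, hxz, hyz, hXeq⟩ := card_eq_three.mp (hF.1 X hX)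
    have hx : x ∈ X := by simp [hXeq]
    have hy : y ∈ X := by simp [hXeq]
    have hz : z ∈ X := by simp [hXeq]
    refine six_le_sum_differenceWeight hH ?_ (hΔ X x hx y hy hxy) (hΔ X y hy z hz hyz)
      (hΔ X z hz x hx hxz.symm) (by abel) (sub_ne_zero.mpr hxy) (sub_ne_zero.mpr hyz)
      (sub_ne_zero.mpr hxz.symm)
    intro d hd
    obtain ⟨⟨u, v⟩, hp, rfl⟩ := mem_image.mp hd
    obtain ⟨hu, hv, huv⟩ := mem_offDiag.mp hp
    rw [neg_sub]
    exact hΔ X v hv u hu huv.symm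
  calc 6 * #F = ∑ X ∈ F, 6 := by rw [sum_const, smul_eq_mul, mul_comm]
    _ ≤ ∑ X ∈ F, ∑ d ∈ Δ X, differenceWeight d := sum_le_sum hweight
    _ = ∑ d ∈ F.biUnion Δ, differenceWeight d := (sum_biUnion hdisj).symm
    _ ≤ ∑ d, differenceWeight d := sum_le_sum_of_subset (subset_univ _)
    _ = _ := sum_differenceWeight H

/-- The Klein four-group splits off. -/
theorem exists_zmod_prod_addEquiv {a b : ℕ} (ha : Odd a) (hb : Odd b) :
    Nonempty (ZMod (2 * a) × ZMod (2 * b) ≃+ (ZMod 2 × ZMod 2) × (ZMod a × ZMod b)) :=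
  ⟨(AddEquiv.prodCongr
    (ZMod.chineseRemainder (Nat.coprime_two_left.mpr ha)).toAddEquiv
    (ZMod.chineseRemainder (Nat.coprime_two_left.mpr hb)).toAddEquiv).trans
    (AddEquiv.prodProdProdComm (ZMod 2) (ZMod a) (ZMod 2) (ZMod b))⟩

theorem threeTorsionCard_eq_xi {a b : ℕ} (ha : 0 < a) (hb : 0 < b) :
    threeTorsionCard (ZMod a × ZMod b) = 2 * xi (2 * a) (2 * b) + 1 := by
  have : NeZero a := ⟨ha.ne'⟩
  have : NeZero b := ⟨hb.ne'⟩
  have hgcd : ∀ c : ℕ, c.gcd 3 = if 3 ∣ c then 3 else 1 := by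
    intro c
    split
    · exact Nat.gcd_eq_right ‹_›
    · exact ((Nat.Prime.coprime_iff_not_dvd Nat.prime_three).mpr ‹_›).symm
  rw [threeTorsionCard_prod, threeTorsionCard_zmod, threeTorsionCard_zmod, hgcd, hgcd, xi]
  simp only [Nat.prime_three.dvd_mul]
  by_cases h : 3 ∣ a <;> by_cases h' : 3 ∣ b <;> simp [h, h']

theorem stmt1 (m n : ℕ) (hm : 0 < m) (hn : 0 < n) (hm4 : m % 4 = 2) (hn4 : n % 4 = 2) :
    IsGreatest {b : ℕ | ∃ F : Finset (Finset (ZMod m × ZMod n)),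
      OOSPC m n 3 3 1 F ∧ F.card = b} ((5 * m * n + 4 + 8 * xi m n) / 24) := by
  obtain ⟨a, rfl⟩ : 2 ∣ m := by omega
  obtain ⟨b, rfl⟩ : 2 ∣ n := by omega
  have ha : Odd a := Nat.odd_iff.mpr (by omega)
  have hb : Odd b := Nat.odd_iff.mpr (by omega)
  have : NeZero a := ⟨ha.pos.ne'⟩
  have : NeZero b := ⟨hb.pos.ne'⟩
  obtain ⟨e⟩ := exists_zmod_prod_addEquiv ha hb
  have hcard : Nat.card (ZMod a × ZMod b) = a * b := by
    rw [Nat.card_prod, Nat.card_zmod, Nat.card_zmod]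
  have hodd : Odd (Nat.card (ZMod a × ZMod b)) := hcard ▸ ha.mul hb
  have hmn : 5 * (2 * a) * (2 * b) = 20 * (a * b) := by ring
  have hxi := threeTorsionCard_eq_xi ha.pos hb.pos
  have upper : ∀ F : Finset (Finset (ZMod (2 * a) × ZMod (2 * b))), OOSPC (2 * a) (2 * b) 3 3 1 F →
      #F ≤ (5 * (2 * a) * (2 * b) + 4 + 8 * xi (2 * a) (2 * b)) / 24 := by
    intro F hF
    have := ((oospc_iff_isTripleCode.mp hF).map e).six_mul_card_le hodd
    rw [card_map, hcard, hxi] at this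
    omega
  refine ⟨?_, ?_⟩
  · obtain ⟨F, hF, hFc⟩ := hasLargeTripleCode_zmod_prod ha hb
    have hF' := oospc_iff_isTripleCode.mpr (hF.map e.symm)
    refine ⟨_, hF', le_antisymm (upper _ hF') ?_⟩
    rw [hcard, hxi] at hFc
    rw [card_map]
    omega
  · rintro _ ⟨F, hF, rfl⟩
    exact upper F hF
end

section
/- Let m and n be positive integers with m odd and let λ_a ∈ {2,3}. Then every (m,n,3,λ_a,1)-OOSPC has at most ⌊(mn+2ω)/4⌋ codewords. -/
open Finset

/-- The nonzero differences of two elements of `X`. -/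
def differences {G : Type*} [AddCommGroup G] [DecidableEq G] (X : Finset G) : Finset G :=
  X.offDiag.image fun p => p.1 - p.2

theorem sub_mem_differences {G : Type*} [AddCommGroup G] [DecidableEq G] {X : Finset G} {x y : G}
    (hx : x ∈ X) (hy : y ∈ X) (hxy : x ≠ y) : x - y ∈ differences X :=
  mem_image.2 ⟨(x, y), mem_offDiag.2 ⟨hx, hy, hxy⟩, rfl⟩

theorem disjoint_differences {G : Type*} [AddCommGroup G] [DecidableEq G] {X Y : Finset G}
    (h : ∀ g : G, (X ∩ Y.image (fun x => g + x)).card ≤ 1) :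
    Disjoint (differences X) (differences Y) := by
  rw [disjoint_left]
  intro d hX hY
  obtain ⟨⟨x, x'⟩, hx, rfl⟩ := mem_image.1 hX
  obtain ⟨⟨y, y'⟩, hy, hd⟩ := mem_image.1 hY
  simp only [mem_offDiag] at hx hy hd
  refine hx.2.2 (card_le_one.1 (h (x - y)) x ?_ x' ?_)
  · exact mem_inter.2 ⟨hx.1, mem_image.2 ⟨y, hy.1, by abel⟩⟩
  · refine mem_inter.2 ⟨hx.2.1, mem_image.2 ⟨y', hy.2.1, ?_⟩⟩
    have : y' = y - (x - x') := by rw [← hd]; abel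
    rw [this]; abel

/-- A three-element set has at least four differences, when those in `T` and those of order two
are counted twice and `T` contains the differences of every coset of a subgroup of order three. -/
theorem four_le_card_differences {G : Type*} [AddCommGroup G] [DecidableEq G]
    {X T I : Finset G} (hI : ∀ u : G, u ∈ I ↔ u ≠ 0 ∧ u + u = 0) (hI1 : I.card ≤ 1)
    (hX : X.card = 3)
    (hT : ∀ x a : G, a ≠ 0 → a + a + a = 0 → X = {x, x + a, x + a + a} → a ∈ T ∧ -a ∈ T) :
    4 ≤ (differences X).card + (differences X ∩ T).card + (differences X ∩ I).card := by
  obtain ⟨x, y, z, hxy, hxz, hyz, rfl⟩ := card_eq_three.1 hX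
  obtain ⟨a, rfl⟩ : ∃ a, y = x + a := ⟨y - x, by abel⟩
  obtain ⟨b, rfl⟩ : ∃ b, z = x + a + b := ⟨z - (x + a), by abel⟩
  set X : Finset G := {x, x + a, x + a + b}
  have ha : a ≠ 0 := by rintro rfl; simp at hxy
  have hb : b ≠ 0 := by rintro rfl; simp at hyz
  have hc : a + b ≠ 0 := by
    intro h; rw [add_assoc, h] at hxz; simp at hxz
  have h1 : x ∈ X := by simp [X]
  have h2 : x + a ∈ X := by simp [X]
  have h3 : x + a + b ∈ X := by simp [X]
  have ma : a ∈ differences X := by simpa using sub_mem_differences h2 h1 hxy.symm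
  have mna : -a ∈ differences X := by simpa using sub_mem_differences h1 h2 hxy
  have mb : b ∈ differences X := by simpa using sub_mem_differences h3 h2 hyz.symm
  have mnb : -b ∈ differences X := by simpa using sub_mem_differences h2 h3 hyz
  have mc : a + b ∈ differences X := by
    simpa [add_assoc] using sub_mem_differences h3 h1 hxz.symm
  have mnc : -(a + b) ∈ differences X := by
    simpa [add_assoc] using sub_mem_differences h1 h3 hxz
  have four : ∀ p q : G, p ∈ differences X → -p ∈ differences X → q ∈ differences X →
      -q ∈ differences X → p + p ≠ 0 → q + q ≠ 0 → p ≠ q → p + q ≠ 0 →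
      4 ≤ (differences X).card := by
    intro p q hp hp' hq hq' h2p h2q hpq hpq'
    have : ({p, -p, q, -q} : Finset G).card = 4 := by
      refine card_eq_succ.2 ⟨p, {-p, q, -q}, ?_, rfl, card_eq_three.2 ⟨-p, q, -q, ?_, ?_, ?_, rfl⟩⟩
      · simpa [eq_neg_iff_add_eq_zero] using ⟨h2p, hpq, hpq'⟩
      · simpa [neg_eq_iff_add_eq_zero] using hpq'
      · simpa using hpq
      · simpa [eq_neg_iff_add_eq_zero] using h2q
    rw [← this]
    exact card_le_card (by simp only [insert_subset_iff, singleton_subset_iff]; tauto)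
  have three : ∀ i p : G, i ≠ 0 → i + i = 0 → i ∈ differences X → p ∈ differences X →
      -p ∈ differences X → p ≠ 0 → p ≠ i →
      4 ≤ (differences X).card + (differences X ∩ I).card := by
    intro i p hi h2i mi mp mp' hp hpi
    have h2p : p + p ≠ 0 := fun h =>
      hpi (card_le_one.1 hI1 p ((hI p).2 ⟨hp, h⟩) i ((hI i).2 ⟨hi, h2i⟩))
    have hne : i ≠ -p := by
      rintro rfl
      exact h2p (by rwa [← neg_add, neg_eq_zero] at h2i)
    have h3 : 3 ≤ (differences X).card := by
      have : ({i, p, -p} : Finset G).card = 3 :=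
        card_eq_three.2 ⟨i, p, -p, hpi.symm, hne, fun h => h2p (eq_neg_iff_add_eq_zero.1 h), rfl⟩
      rw [← this]
      exact card_le_card (by simp only [insert_subset_iff, singleton_subset_iff]; tauto)
    have h1 : 0 < (differences X ∩ I).card :=
      card_pos.2 ⟨i, mem_inter.2 ⟨mi, (hI i).2 ⟨hi, h2i⟩⟩⟩
    lia
  by_cases h2a : a + a = 0
  · have := three a b ha h2a ma mb mnb hb (by rintro rfl; exact hc h2a)
    lia
  by_cases h2b : b + b = 0
  · have := three b a hb h2b mb ma mna ha (by rintro rfl; exact hc h2b)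
    lia
  by_cases h2c : (a + b) + (a + b) = 0
  · have := three (a + b) a hc h2c mc ma mna ha (by simpa using hb)
    lia
  by_cases hab : a = b
  · subst hab
    by_cases h3a : a + a + a = 0
    · obtain ⟨ta, tna⟩ := hT x a ha h3a rfl
      have h : ({a, -a} : Finset G).card = 2 :=
        card_pair fun h => h2a (eq_neg_iff_add_eq_zero.1 h)
      have hD : 2 ≤ (differences X).card :=
        h ▸ card_le_card (by simp only [insert_subset_iff, singleton_subset_iff]; tauto)
      have hDT : 2 ≤ (differences X ∩ T).card :=
        h ▸ card_le_card (by
          simp only [insert_subset_iff, singleton_subset_iff, mem_inter]; tauto)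
      lia
    · have := four a (a + a) ma mna mc mnc h2a h2c (by simpa using ha) (by rwa [← add_assoc])
      lia
  · have := four a b ma mna mb mnb h2a h2b hab hc
    lia

theorem card_zmod_triple_eq_zero_le (m : ℕ) [NeZero m] :
    (univ.filter fun u : ZMod m => 3 • u = 0).card ≤ if 3 ∣ m then 3 else 1 := by
  split_ifs with h
  · exact IsAddCyclic.card_nsmul_eq_zero_le (by lia)
  · refine card_le_one.2 fun u hu v hv => ?_
    have hz : ∀ w : ZMod m, 3 • w = 0 → w = 0 := by
      intro w hw
      have h3 : addOrderOf w ∣ 3 := addOrderOf_dvd_of_nsmul_eq_zero hw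
      have hm : addOrderOf w ∣ m := by simpa using addOrderOf_dvd_card (x := w)
      rcases (Nat.dvd_prime Nat.prime_three).1 h3 with h1 | h1
      · exact AddMonoid.addOrderOf_eq_one_iff.1 h1
      · exact absurd (h1 ▸ hm) h
    rw [hz u (mem_filter.1 hu).2, hz v (mem_filter.1 hv).2]

/-- The number of elements of order three is twice the number of subgroups of order three. -/
theorem card_order_three_le (m n : ℕ) [NeZero m] [NeZero n] :
    (univ.filter fun u : ZMod m × ZMod n => u ≠ 0 ∧ 3 • u = 0).card ≤ 2 * xi m n := by
  have hlt : (univ.filter fun u : ZMod m × ZMod n => u ≠ 0 ∧ 3 • u = 0).card <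
      (univ.filter fun u : ZMod m × ZMod n => 3 • u = 0).card := by
    refine card_lt_card ((ssubset_iff_of_subset ?_).2 ⟨0, by simp, by simp⟩)
    exact monotone_filter_right _ fun u _ hu => hu.2
  have heq : (univ.filter fun u : ZMod m × ZMod n => 3 • u = 0) =
      (univ.filter fun u : ZMod m => 3 • u = 0) ×ˢ (univ.filter fun u : ZMod n => 3 • u = 0) := by
    ext ⟨u, v⟩
    simp [Prod.ext_iff]
  rw [heq, card_product] at hlt
  have hle := Nat.mul_le_mul (card_zmod_triple_eq_zero_le m) (card_zmod_triple_eq_zero_le n)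
  have hlt' := hlt.trans_le hle
  unfold xi
  simp only [Nat.prime_three.dvd_mul]
  by_cases h1 : 3 ∣ m <;> by_cases h2 : 3 ∣ n <;> simp [h1, h2] at hlt' ⊢ <;> lia

theorem card_order_two_le_one (m n : ℕ) [NeZero m] [NeZero n] (hm : Odd m) :
    (univ.filter fun u : ZMod m × ZMod n => u ≠ 0 ∧ u + u = 0).card ≤ 1 := by
  have hfst : ∀ u : ZMod m, u + u = 0 → u = 0 := by
    intro u hu
    exact (ZMod.add_self_eq_zero_iff_eq_zero hm).1 hu
  have hcard : (univ.filter fun v : ZMod n => 2 • v = 0).card ≤ 2 :=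
    IsAddCyclic.card_nsmul_eq_zero_le (by lia)
  have hlt : (univ.filter fun v : ZMod n => v ≠ 0 ∧ v + v = 0).card <
      (univ.filter fun v : ZMod n => 2 • v = 0).card := by
    refine card_lt_card ((ssubset_iff_of_subset ?_).2 ⟨0, by simp, by simp⟩)
    exact monotone_filter_right _ fun v _ hv => (two_nsmul v).trans hv.2
  refine le_trans (card_le_card_of_injOn Prod.snd ?_ ?_) (Nat.le_of_lt_succ (hlt.trans_le hcard))
  · rintro ⟨u, v⟩ huv
    simp only [coe_filter, mem_univ, true_and, Set.mem_ofPred_eq, Prod.mk_add_mk,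
      Prod.mk_eq_zero] at huv ⊢
    exact ⟨fun hv => huv.1 (Prod.ext (hfst u huv.2.1) hv), huv.2.2⟩
  · rintro ⟨u, v⟩ huv ⟨u', v'⟩ huv' h
    simp only [coe_filter, mem_univ, true_and, Set.mem_ofPred_eq, Prod.mk_add_mk,
      Prod.mk_eq_zero] at huv huv'
    exact Prod.ext ((hfst u huv.2.1).trans (hfst u' huv'.2.1).symm) h

theorem sum_card_differences_inter_le {G : Type*} [AddCommGroup G] [DecidableEq G]
    {F : Finset (Finset G)}
    (h : ∀ X ∈ F, ∀ Y ∈ F, X ≠ Y → ∀ g : G, (X ∩ Y.image (fun x => g + x)).card ≤ 1)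
    (S : Finset G) : ∑ X ∈ F, (differences X ∩ S).card ≤ S.card := by
  rw [← card_biUnion fun X hX Y hY hXY =>
    (disjoint_differences (h X hX Y hY hXY)).mono inter_subset_left inter_subset_left]
  exact card_le_card (biUnion_subset.2 fun X _ => inter_subset_right)

theorem stmt2 (m n lamA : ℕ) (hm : 0 < m) (hn : 0 < n) (hmo : Odd m)
    (hl : lamA = 2 ∨ lamA = 3)
    (F : Finset (Finset (ZMod m × ZMod n))) (hF : OOSPC m n 3 lamA 1 F) :
    F.card ≤ (m * n + 2 * omega lamA m n) / 4 := by
  have : NeZero m := ⟨hm.ne'⟩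
  have : NeZero n := ⟨hn.ne'⟩
  obtain ⟨hcard, hauto, hcross⟩ := hF
  set I := univ.filter fun u : ZMod m × ZMod n => u ≠ 0 ∧ u + u = 0
  let T := if lamA = 2 then ∅ else univ.filter fun u : ZMod m × ZMod n => u ≠ 0 ∧ 3 • u = 0
  have hT : T.card ≤ 2 * omega lamA m n := by
    unfold T omega
    split_ifs
    · simp
    · exact card_order_three_le m n
  have hI : I.card ≤ 1 := card_order_two_le_one m n hmo
  have hword : ∀ X ∈ F, 4 ≤ (differences X ∩ univ.erase 0).card + (differences X ∩ T).card +
      (differences X ∩ I).card := by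
    intro X hX
    have hD : differences X ∩ univ.erase 0 = differences X := by
      refine inter_eq_left.2 fun d hd => ?_
      obtain ⟨⟨x, y⟩, hxy, rfl⟩ := mem_image.1 hd
      simpa [sub_eq_zero] using (mem_offDiag.1 hxy).2.2
    rw [hD]
    refine four_le_card_differences (fun u => by simp [I]) hI (hcard X hX) ?_
    intro x a ha h3a hXa
    have h3 : 3 • a = 0 := by rw [← h3a]; abel
    by_cases hl2 : lamA = 2
    · exfalso
      have himg : X ⊆ X.image fun x => a + x := by
        have hx : x = a + (x + a + a) := by
          rw [show a + (x + a + a) = x + (a + a + a) by abel, h3a, add_zero]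
        rw [hXa]
        simp only [insert_subset_iff, singleton_subset_iff, mem_image, mem_insert, mem_singleton]
        exact ⟨⟨_, by simp, hx.symm⟩, ⟨x, by simp, add_comm _ _⟩, ⟨x + a, by simp, add_comm _ _⟩⟩
      have := hauto X hX a ha
      rw [inter_eq_left.2 himg, hcard X hX] at this
      lia
    · simp only [T, if_neg hl2, mem_filter, mem_univ, true_and, smul_neg, h3, neg_zero,
        neg_ne_zero, and_true, and_self]
      exact ha
  have hsum := sum_le_sum hword
  simp only [sum_const, smul_eq_mul, sum_add_distrib] at hsum
  have h0 := sum_card_differences_inter_le hcross (univ.erase 0)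
  have h1 := sum_card_differences_inter_le hcross T
  have h2 := sum_card_differences_inter_le hcross I
  rw [card_erase_of_mem (mem_univ _), card_univ, Fintype.card_prod, ZMod.card, ZMod.card] at h0
  have := Nat.mul_pos hm hn
  rw [Nat.le_div_iff_mul_le (by norm_num)]
  lia
end

section
/- Let m and n be positive integers with m ≡ 2 (mod 4) and let λ_a ∈ {2,3}. If n ≡ 2 (mod 4), then every (m,n,3,λ_a,1)-OOSPC has at most ⌊(5mn+4+8ω)/24⌋ codewords; if n ≡ 0 (mod 4), then every (m,n,3,λ_a,1)-OOSPC has at most ⌊(5mn+8+8ω)/24⌋ codewords. -/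
open Finset

section Weights

variable {G : Type*} [AddCommGroup G] [DecidableEq G]

/-- The set `{a, -a}` has weight at least `2k` if each element has weight at least `k`, and at
least `2k` when it is an involution. -/
lemma two_mul_le_sum_pair {W : G → ℕ} (hneg : ∀ g, W (-g) = W g) {a : G} {k : ℕ}
    (h : k ≤ W a) (h' : a + a = 0 → 2 * k ≤ W a) : 2 * k ≤ ∑ g ∈ {a, -a}, W g := by
  by_cases ha : a = -a
  · have : a + a = 0 := by rw [← eq_neg_iff_add_eq_zero]; exact ha
    rw [← ha]
    simpa using h' this
  · rw [sum_pair ha, hneg]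
    omega

lemma disjoint_pairs {a b : G} (h : a ≠ b) (h' : a + b ≠ 0) :
    Disjoint ({a, -a} : Finset G) {b, -b} := by
  have h1 : a ≠ -b := fun e => h' (eq_neg_iff_add_eq_zero.mp e)
  rw [Finset.disjoint_left]
  intro g hg hg'
  simp only [mem_insert, mem_singleton] at hg hg'
  rcases hg with rfl | rfl <;> rcases hg' with e | e
  · exact h e
  · exact h1 e
  · exact h1 (by rw [← e, neg_neg])
  · exact h (neg_injective e)

/-- The conditions on a weight function guaranteeing that the difference set of every triple,
except possibly cosets of subgroups of order three, has weight at least six. -/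
structure IsDiffWeight (W : G → ℕ) : Prop where
  neg : ∀ g, W (-g) = W g
  one_le : ∀ g, 1 ≤ W g
  two_le : ∀ g, g + g = 0 → 2 ≤ W g
  double : ∀ g, 2 ≤ W (g + g)
  double_involution : ∀ g, (g + g) + (g + g) = 0 → 4 ≤ W (g + g)

lemma IsDiffWeight.six_le_of_eq {W : G → ℕ} (hW : IsDiffWeight W) {a c : G}
    (ha : a ≠ 0) (hc : c ≠ 0) (hs : a + a + c = 0) (h3 : a = c → 3 ≤ W a)
    {D : Finset G} (haD : {a, -a} ⊆ D) (hcD : {c, -c} ⊆ D) : 6 ≤ ∑ g ∈ D, W g := by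
  have hca : c = -(a + a) := by rw [eq_neg_iff_add_eq_zero, add_comm]; exact hs
  by_cases hac : a = c
  · refine le_trans ?_ (sum_le_sum_of_subset haD)
    refine two_mul_le_sum_pair (k := 3) hW.neg (h3 hac) fun h => ?_
    rw [h, zero_add] at hs
    exact absurd hs hc
  · have hac' : a + c ≠ 0 := by
      intro h
      rw [add_assoc, h, add_zero] at hs
      exact ha hs
    refine le_trans ?_ (sum_le_sum_of_subset (union_subset haD hcD))
    rw [sum_union (disjoint_pairs hac hac')]
    have e1 : 2 * 1 ≤ ∑ g ∈ {a, -a}, W g :=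
      two_mul_le_sum_pair hW.neg (hW.one_le a) (hW.two_le a)
    have e2 : 2 * 2 ≤ ∑ g ∈ {c, -c}, W g := by
      apply two_mul_le_sum_pair hW.neg
      · rw [hca, hW.neg]
        exact hW.double a
      · intro h
        rw [hca, hW.neg]
        apply hW.double_involution
        rw [hca, ← neg_add, neg_eq_zero] at h
        exact h
    omega

lemma IsDiffWeight.six_le {W : G → ℕ} (hW : IsDiffWeight W) {a b c : G}
    (ha : a ≠ 0) (hb : b ≠ 0) (hc : c ≠ 0) (hs : a + b + c = 0)
    (h3 : a = b → b = c → 3 ≤ W a)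
    {D : Finset G} (haD : {a, -a} ⊆ D) (hbD : {b, -b} ⊆ D) (hcD : {c, -c} ⊆ D) :
    6 ≤ ∑ g ∈ D, W g := by
  by_cases hab : a = b
  · subst hab
    exact hW.six_le_of_eq ha hc hs (h3 rfl) haD hcD
  by_cases hbc : b = c
  · subst hbc
    exact hW.six_le_of_eq hb ha (by rw [← hs]; abel) (fun h => absurd h.symm hab) hbD haD
  by_cases hac : a = c
  · subst hac
    exact hW.six_le_of_eq ha hb (by rw [← hs]; abel) (fun h => absurd h hab) haD hbD
  have nab : a + b ≠ 0 := fun h => hc (by simpa [h] using hs)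
  have nac : a + c ≠ 0 := fun h => hb (by rw [add_right_comm, h, zero_add] at hs; exact hs)
  have nbc : b + c ≠ 0 := fun h => ha (by rw [add_assoc, h, add_zero] at hs; exact hs)
  refine le_trans ?_ (sum_le_sum_of_subset (union_subset (union_subset haD hbD) hcD))
  rw [sum_union (disjoint_union_left.mpr ⟨disjoint_pairs hac nac, disjoint_pairs hbc nbc⟩),
    sum_union (disjoint_pairs hab nab)]
  have e (x : G) : 2 * 1 ≤ ∑ g ∈ {x, -x}, W g :=
    two_mul_le_sum_pair hW.neg (hW.one_le x) (hW.two_le x)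
  have := e a
  have := e b
  have := e c
  omega

/-- The set of nonzero differences of a finite set. -/
def diffSet (X : Finset G) : Finset G := X.offDiag.image fun p => p.1 - p.2

lemma mem_diffSet {X : Finset G} {g : G} :
    g ∈ diffSet X ↔ ∃ x ∈ X, ∃ y ∈ X, x ≠ y ∧ x - y = g := by
  simp only [diffSet, mem_image, mem_offDiag, Prod.exists]
  constructor
  · rintro ⟨x, y, ⟨hx, hy, h⟩, e⟩
    exact ⟨x, hx, y, hy, h, e⟩
  · rintro ⟨x, hx, y, hy, h, e⟩
    exact ⟨x, y, ⟨hx, hy, h⟩, e⟩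

lemma pair_subset_diffSet {X : Finset G} {x y : G} (hx : x ∈ X) (hy : y ∈ X) (h : x ≠ y) :
    {x - y, -(x - y)} ⊆ diffSet X := by
  intro g hg
  simp only [mem_insert, mem_singleton, neg_sub] at hg
  rcases hg with rfl | rfl
  · exact mem_diffSet.mpr ⟨x, hx, y, hy, h, rfl⟩
  · exact mem_diffSet.mpr ⟨y, hy, x, hx, h.symm, rfl⟩

/-- A triple whose stabilizer under translation is trivial (or such that elements of order three
weigh at least three) has a difference set of weight at least six. -/
lemma IsDiffWeight.six_le_diffSet {W : G → ℕ} (hW : IsDiffWeight W) {X : Finset G}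
    (hX : X.card = 3)
    (h3 : (∀ g, g + g + g = 0 → 3 ≤ W g) ∨
      ∀ g, g ≠ 0 → (X ∩ X.image (fun x => g + x)).card ≤ 2) :
    6 ≤ ∑ g ∈ diffSet X, W g := by
  obtain ⟨x, y, z, hxy, hxz, hyz, rfl⟩ := card_eq_three.mp hX
  refine hW.six_le (a := x - y) (b := y - z) (c := z - x) (sub_ne_zero.mpr hxy)
    (sub_ne_zero.mpr hyz) (sub_ne_zero.mpr hxz.symm) (by abel) ?_
    (pair_subset_diffSet (by simp) (by simp) hxy) (pair_subset_diffSet (by simp) (by simp) hyz)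
    (pair_subset_diffSet (by simp) (by simp) hxz.symm)
  intro e1 e2
  rcases h3 with h3 | h3
  · apply h3
    nth_rewrite 2 [e1]
    rw [e1.trans e2]
    nth_rewrite 1 [← e2, ← e1]
    abel
  · exfalso
    have key : ({x, y, z} : Finset G) ⊆
        {x, y, z} ∩ ({x, y, z} : Finset G).image (fun t => (x - y) + t) := by
      intro t ht
      refine mem_inter.mpr ⟨ht, mem_image.mpr ?_⟩
      simp only [mem_insert, mem_singleton] at ht
      rcases ht with rfl | rfl | rfl
      · exact ⟨y, by simp, by abel⟩
      · exact ⟨z, by simp, by rw [e1]; abel⟩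
      · exact ⟨x, by simp, by rw [e1, e2]; abel⟩
    have := card_le_card key
    have := h3 (x - y) (sub_ne_zero.mpr hxy)
    omega

lemma disjoint_diffSet {X Y : Finset G}
    (h : ∀ g, (X ∩ Y.image (fun x => g + x)).card ≤ 1) :
    Disjoint (diffSet X) (diffSet Y) := by
  rw [Finset.disjoint_left]
  intro g hgX hgY
  obtain ⟨x, hx, x', hx', hne, rfl⟩ := mem_diffSet.mp hgX
  obtain ⟨y, hy, y', hy', -, e⟩ := mem_diffSet.mp hgY
  refine hne (card_le_one.mp (h (x - y)) x ?_ x' ?_)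
  · exact mem_inter.mpr ⟨hx, mem_image.mpr ⟨y, hy, by abel⟩⟩
  · refine mem_inter.mpr ⟨hx', mem_image.mpr ⟨y', hy', ?_⟩⟩
    have : y' = y - (x - x') := by rw [← e]; abel
    rw [this]
    abel

end Weights

/-- Elements of `Z_m × Z_n` both of whose coordinates are even (for `m`, `n` even). -/
def EvenPair {m n : ℕ} (g : ZMod m × ZMod n) : Prop :=
  (ZMod.cast g.1 : ZMod 2) = 0 ∧ (ZMod.cast g.2 : ZMod 2) = 0

instance {m n : ℕ} : DecidablePred (EvenPair (m := m) (n := n)) :=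
  fun _ => inferInstanceAs (Decidable (_ ∧ _))

/-- Weights showing optimality: even elements weigh twice as much as the others, weights of
involutions are doubled, and elements of order three get an extra `h`. -/
def codeWeight {m n : ℕ} (h : ℕ) (g : ZMod m × ZMod n) : ℕ :=
  1 + (if EvenPair g then 1 else 0) + (if g + g = 0 then 1 else 0) +
    (if EvenPair g ∧ g + g = 0 then 1 else 0) + h * (if g + g + g = 0 then 1 else 0)

section Parity

variable {m n : ℕ}

lemma cast_two_add (hm : 2 ∣ m) (a b : ZMod m) :
    (ZMod.cast (a + b) : ZMod 2) = ZMod.cast a + ZMod.cast b := ZMod.cast_add hm a b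

lemma evenPair_add_self (hm : 2 ∣ m) (hn : 2 ∣ n) (g : ZMod m × ZMod n) : EvenPair (g + g) := by
  simp only [EvenPair, Prod.fst_add, Prod.snd_add, cast_two_add hm, cast_two_add hn,
    CharTwo.add_self_eq_zero, and_self]

lemma evenPair_of_three (hm : 2 ∣ m) (hn : 2 ∣ n) {g : ZMod m × ZMod n} (h : g + g + g = 0) :
    EvenPair g := by
  have : g = (-g) + (-g) := by rw [← sub_eq_zero, ← h]; abel
  rw [this]
  exact evenPair_add_self hm hn _

lemma evenPair_neg (hm : 2 ∣ m) (hn : 2 ∣ n) (g : ZMod m × ZMod n) :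
    EvenPair (-g) ↔ EvenPair g := by
  simp only [EvenPair, Prod.fst_neg, Prod.snd_neg, ZMod.cast_neg hm, ZMod.cast_neg hn,
    neg_eq_zero]

lemma isDiffWeight_codeWeight (hm : 2 ∣ m) (hn : 2 ∣ n) (h : ℕ) :
    IsDiffWeight (codeWeight (m := m) (n := n) h) where
  neg g := by
    simp only [codeWeight, evenPair_neg hm hn, ← neg_add, neg_eq_zero]
  one_le g := by
    unfold codeWeight
    omega
  two_le g hg := by
    simp only [codeWeight, hg, if_true]
    omega
  double g := by
    simp only [codeWeight, evenPair_add_self hm hn, if_true]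
    omega
  double_involution g hg := by
    simp only [codeWeight, evenPair_add_self hm hn, hg, if_true, and_self]
    omega

lemma three_le_codeWeight_one (hm : 2 ∣ m) (hn : 2 ∣ n) (g : ZMod m × ZMod n)
    (hg : g + g + g = 0) : 3 ≤ codeWeight 1 g := by
  simp only [codeWeight, evenPair_of_three hm hn hg, hg, if_true]
  omega

end Parity

section Counting

variable {n : ℕ} [NeZero n]

lemma two_mul_card_even (hn : 2 ∣ n) :
    2 * #{a : ZMod n | (ZMod.cast a : ZMod 2) = 0} = n := by
  have h := card_filter_add_card_filter_not (s := (univ : Finset (ZMod n)))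
    (fun a => (ZMod.cast a : ZMod 2) = 0)
  rw [card_univ, ZMod.card] at h
  have h' : #{a : ZMod n | (ZMod.cast a : ZMod 2) = 0} =
      #{a : ZMod n | ¬ (ZMod.cast a : ZMod 2) = 0} := by
    refine card_bij' (fun a _ => a + 1) (fun a _ => a - 1) ?_ ?_ (by simp) (by simp)
    · intro a ha
      simp only [mem_filter, mem_univ, true_and] at ha ⊢
      rw [ZMod.cast_add hn, ZMod.cast_one hn, ha]
      decide
    · intro a ha
      simp only [mem_filter, mem_univ, true_and] at ha ⊢
      rw [ZMod.cast_sub hn, ZMod.cast_one hn]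
      generalize (ZMod.cast a : ZMod 2) = t at ha
      revert t
      decide
  omega

lemma card_add_self_eq_zero_le : #{a : ZMod n | a + a = 0} ≤ 2 := by
  simpa only [two_nsmul] using IsAddCyclic.card_nsmul_eq_zero_le (α := ZMod n) (n := 2) (by norm_num)

lemma card_three_le : #{a : ZMod n | a + a + a = 0} ≤ 3 := by
  have := IsAddCyclic.card_nsmul_eq_zero_le (α := ZMod n) (n := 3) (by norm_num)
  simpa only [succ_nsmul, zero_nsmul, zero_add] using this

lemma card_three_le_one (h : ¬ 3 ∣ n) : #{a : ZMod n | a + a + a = 0} ≤ 1 := by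
  have key : ∀ a : ZMod n, a + a + a = 0 → a = 0 := by
    intro a ha
    have hu : IsUnit ((3 : ℕ) : ZMod n) :=
      (ZMod.isUnit_iff_coprime 3 n).mpr ((Nat.Prime.coprime_iff_not_dvd Nat.prime_three).mpr h)
    have h3 : ((3 : ℕ) : ZMod n) * a = 0 := by
      rw [← ha]; push_cast; ring
    exact (hu.mul_right_eq_zero).mp h3
  rw [card_le_one]
  intro a ha b hb
  simp only [mem_filter, mem_univ, true_and] at ha hb
  rw [key a ha, key b hb]

lemma card_even_add_self_le_two :
    #{a : ZMod n | (ZMod.cast a : ZMod 2) = 0 ∧ a + a = 0} ≤ 2 :=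
  (card_le_card (monotone_filter_right _ fun _ _ h => h.2)).trans card_add_self_eq_zero_le

lemma card_even_add_self_le_one (hn : n % 4 = 2) :
    #{a : ZMod n | (ZMod.cast a : ZMod 2) = 0 ∧ a + a = 0} ≤ 1 := by
  have key : ∀ a : ZMod n, (ZMod.cast a : ZMod 2) = 0 → a + a = 0 → a = 0 := by
    intro a h1 h2
    rw [ZMod.cast_eq_val, ZMod.natCast_eq_zero_iff] at h1
    have h3 : ((a.val + a.val : ℕ) : ZMod n) = 0 := by
      push_cast
      rw [ZMod.natCast_zmod_val, h2]
    rw [ZMod.natCast_eq_zero_iff] at h3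
    have hlt := ZMod.val_lt a
    rw [← ZMod.val_eq_zero]
    obtain ⟨k, hk⟩ := h3
    have hk2 : k < 2 := by
      by_contra hk2
      have : n * 2 ≤ n * k := Nat.mul_le_mul_left n (by omega)
      omega
    interval_cases k <;> omega
  rw [card_le_one]
  intro a ha b hb
  simp only [mem_filter, mem_univ, true_and] at ha hb
  rw [key a ha.1 ha.2, key b hb.1 hb.2]

end Counting

lemma card_filter_prod_le {α β : Type*} [Fintype α] [Fintype β] {p : α × β → Prop}
    {q : α → Prop} {r : β → Prop} [DecidablePred p] [DecidablePred q] [DecidablePred r]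
    (h : ∀ x, p x → q x.1 ∧ r x.2) :
    #{x | p x} ≤ #{a | q a} * #{b | r b} := by
  rw [← card_product]
  refine card_le_card fun x hx => ?_
  simpa using h x (by simpa using hx)

lemma card_three_prod_le {m n : ℕ} [NeZero m] [NeZero n] :
    #{g : ZMod m × ZMod n | g + g + g = 0} ≤ 1 + 2 * xi m n := by
  have h := card_filter_prod_le (p := fun g : ZMod m × ZMod n => g + g + g = 0)
    (q := fun a => a + a + a = 0) (r := fun b => b + b + b = 0)
    (fun x hx => ⟨congrArg Prod.fst hx, congrArg Prod.snd hx⟩)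
  refine h.trans ?_
  have hm := card_three_le (n := m)
  have hn := card_three_le (n := n)
  unfold xi
  simp only [Nat.prime_three.dvd_mul]
  by_cases h1 : 3 ∣ m <;> by_cases h2 : 3 ∣ n
  · simpa [h1, h2] using Nat.mul_le_mul hm hn
  · simpa [h1, h2] using Nat.mul_le_mul hm (card_three_le_one h2)
  · simpa [h1, h2] using Nat.mul_le_mul (card_three_le_one h1) hn
  · simpa [h1, h2] using Nat.mul_le_mul (card_three_le_one h1) (card_three_le_one h2)

lemma four_mul_sum_codeWeight_le {m n : ℕ} [NeZero m] [NeZero n] (hm : m % 4 = 2) (hn : 2 ∣ n)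
    (h : ℕ) {c : ℕ} (hc : #{a : ZMod n | (ZMod.cast a : ZMod 2) = 0 ∧ a + a = 0} ≤ c) :
    4 * ∑ g ∈ univ.erase (0 : ZMod m × ZMod n), codeWeight h g ≤
      5 * m * n + 4 * c + 8 * (h * xi m n) := by
  have hm2 : 2 ∣ m := by omega
  have h0 : codeWeight h (0 : ZMod m × ZMod n) = 4 + h := by
    simp [codeWeight, EvenPair]
  have hsum := add_sum_erase univ (codeWeight h) (mem_univ (0 : ZMod m × ZMod n))
  have htot : ∑ g : ZMod m × ZMod n, codeWeight h g = m * n + #{g : ZMod m × ZMod n | EvenPair g}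
      + #{g : ZMod m × ZMod n | g + g = 0} + #{g : ZMod m × ZMod n | EvenPair g ∧ g + g = 0}
      + h * #{g : ZMod m × ZMod n | g + g + g = 0} := by
    simp only [codeWeight, sum_add_distrib, card_filter, mul_sum]
    simp
  have c1 : #{g : ZMod m × ZMod n | EvenPair g} ≤ _ :=
    card_filter_prod_le (q := fun a => (ZMod.cast a : ZMod 2) = 0)
      (r := fun b => (ZMod.cast b : ZMod 2) = 0) fun x hx => hx
  have c2 : #{g : ZMod m × ZMod n | g + g = 0} ≤ 2 * 2 :=
    (card_filter_prod_le (q := fun a => a + a = 0) (r := fun b => b + b = 0)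
      fun x hx => ⟨congrArg Prod.fst hx, congrArg Prod.snd hx⟩).trans
      (Nat.mul_le_mul card_add_self_eq_zero_le card_add_self_eq_zero_le)
  have c3 : #{g : ZMod m × ZMod n | EvenPair g ∧ g + g = 0} ≤ 1 * c :=
    (card_filter_prod_le (q := fun a => (ZMod.cast a : ZMod 2) = 0 ∧ a + a = 0)
      (r := fun b => (ZMod.cast b : ZMod 2) = 0 ∧ b + b = 0)
      fun x hx => ⟨⟨hx.1.1, congrArg Prod.fst hx.2⟩, ⟨hx.1.2, congrArg Prod.snd hx.2⟩⟩).trans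
      (Nat.mul_le_mul (card_even_add_self_le_one hm) hc)
  have c4 := Nat.mul_le_mul_left h (card_three_prod_le (m := m) (n := n))
  have em := two_mul_card_even hm2
  have en := two_mul_card_even hn
  have emn : 4 * (#{a : ZMod m | (ZMod.cast a : ZMod 2) = 0} *
      #{b : ZMod n | (ZMod.cast b : ZMod 2) = 0}) = m * n := by
    conv_rhs => rw [← em, ← en]
    ring
  have c5 : h * (1 + 2 * xi m n) = h + 2 * (h * xi m n) := by ring
  rw [mul_assoc]
  omega

lemma OOSPC.card_mul_le {m n lamA : ℕ} [NeZero m] [NeZero n] (hm : m % 4 = 2) (hn : 2 ∣ n)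
    (hl : lamA = 2 ∨ lamA = 3) {F : Finset (Finset (ZMod m × ZMod n))}
    (hF : OOSPC m n 3 lamA 1 F) {c : ℕ}
    (hc : #{a : ZMod n | (ZMod.cast a : ZMod 2) = 0 ∧ a + a = 0} ≤ c) :
    24 * F.card ≤ 5 * m * n + 4 * c + 8 * omega lamA m n := by
  obtain ⟨hk, ha, hcr⟩ := hF
  have hm2 : 2 ∣ m := by omega
  obtain ⟨h, hω, h3⟩ : ∃ h, omega lamA m n = h * xi m n ∧ ∀ X ∈ F,
      (∀ g : ZMod m × ZMod n, g + g + g = 0 → 3 ≤ codeWeight h g) ∨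
      ∀ g, g ≠ 0 → (X ∩ X.image (fun x => g + x)).card ≤ 2 := by
    rcases hl with rfl | rfl
    · exact ⟨0, by simp [omega], fun X hX => Or.inr (ha X hX)⟩
    · exact ⟨1, by simp [omega], fun X hX => Or.inl (three_le_codeWeight_one hm2 hn)⟩
  have h6 : F.card * 6 ≤ ∑ X ∈ F, ∑ g ∈ diffSet X, codeWeight h g := by
    rw [← smul_eq_mul]
    exact card_nsmul_le_sum _ _ _ fun X hX =>
      (isDiffWeight_codeWeight hm2 hn h).six_le_diffSet (hk X hX) (h3 X hX)
  rw [← sum_biUnion fun X hX Y hY hne => disjoint_diffSet (hcr X hX Y hY hne)] at h6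
  have hsub : (F.biUnion fun X => diffSet X) ⊆ univ.erase 0 := by
    intro g hg
    obtain ⟨X, -, hX⟩ := mem_biUnion.mp hg
    obtain ⟨x, -, y, -, hne, rfl⟩ := mem_diffSet.mp hX
    simpa using sub_ne_zero.mpr hne
  have h7 := sum_le_sum_of_subset (f := codeWeight h) hsub
  have h8 := four_mul_sum_codeWeight_le hm hn h hc
  rw [hω]
  omega

theorem stmt3 (m n lamA : ℕ) (hm : 0 < m) (hn : 0 < n) (hm4 : m % 4 = 2)
    (hl : lamA = 2 ∨ lamA = 3)
    (F : Finset (Finset (ZMod m × ZMod n))) (hF : OOSPC m n 3 lamA 1 F) :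
    (n % 4 = 2 → F.card ≤ (5 * m * n + 4 + 8 * omega lamA m n) / 24) ∧
    (n % 4 = 0 → F.card ≤ (5 * m * n + 8 + 8 * omega lamA m n) / 24) := by
  have : NeZero m := ⟨hm.ne'⟩
  have : NeZero n := ⟨hn.ne'⟩
  constructor <;> intro hn4 <;> rw [Nat.le_div_iff_mul_le (by norm_num), mul_comm]
  · exact hF.card_mul_le hm4 (by omega) hl (card_even_add_self_le_one hn4)
  · exact hF.card_mul_le hm4 (by omega) hl card_even_add_self_le_two
end
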